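/- arXiv:1609.04362 — 2 statements merged into one kernel-verified Lean document; each statement's English description precedes it below -/
import Mathlib

section
/- Let (L,Δ,S) be a locality, let L' be a partial group, and let β : L → L' be a projection of partial groups. If N is a partial normal subgroup of L, then Nβ is a partial normal subgroup of L'. -/
/-!
Background definitions for partial groups and localities in the sense of Chermak.

A *partial group* is given by `Data`: a domain `D` of words, a (total, but only
meaningful on `D`) product `pi : List L → L`, and an inversion map, subject to the
axioms collected in `IsPartialGroup`.
-/

namespace PartialGroups

/-- The underlying data of a partial group. -/
structure Data (L : Type*) where
  /-- The domain of the product, a set of words. -/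
  D : Set (List L)
  /-- The product `Π`, meaningful on `D`. -/
  pi : List L → L
  /-- The inversion map. -/
  inv : L → L

variable {L L' L₁ L₂ L₁' L₂' : Type*}

/-- The formal inverse of a word: `(f₁,…,fₙ)⁻¹ = (fₙ⁻¹,…,f₁⁻¹)`. -/
def Data.wInv (P : Data L) (w : List L) : List L := (w.map P.inv).reverse

/-- The identity element `1 = Π(∅)`. -/
def Data.one (P : Data L) : L := P.pi []

/-- The axioms of a partial group. -/
structure IsPartialGroup (P : Data L) : Prop where
  /-- Inversion is an involution (in particular a bijection). -/
  inv_inv : ∀ f : L, P.inv (P.inv f) = f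
  /-- `L ⊆ D` (words of length one lie in the domain). -/
  singleton_mem : ∀ f : L, [f] ∈ P.D
  /-- `u ∘ v ∈ D` implies `u ∈ D`. -/
  append_left : ∀ u v : List L, u ++ v ∈ P.D → u ∈ P.D
  /-- `u ∘ v ∈ D` implies `v ∈ D`. -/
  append_right : ∀ u v : List L, u ++ v ∈ P.D → v ∈ P.D
  /-- `Π` restricts to the identity on words of length one. -/
  pi_singleton : ∀ f : L, P.pi [f] = f
  /-- `u ∘ v ∘ w ∈ D` implies `u ∘ (Π(v)) ∘ w ∈ D`. -/
  assoc_mem : ∀ u v w : List L, u ++ v ++ w ∈ P.D → u ++ [P.pi v] ++ w ∈ P.D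
  /-- `Π(u ∘ v ∘ w) = Π(u ∘ (Π(v)) ∘ w)`. -/
  assoc_pi : ∀ u v w : List L, u ++ v ++ w ∈ P.D →
    P.pi (u ++ v ++ w) = P.pi (u ++ [P.pi v] ++ w)
  /-- `w ∈ D` implies `w⁻¹ ∘ w ∈ D`. -/
  wInv_mem : ∀ w ∈ P.D, P.wInv w ++ w ∈ P.D
  /-- `Π(w⁻¹ ∘ w) = 1`. -/
  wInv_pi : ∀ w ∈ P.D, P.pi (P.wInv w ++ w) = P.one

/-- `D(g)`: the set of `x` for which `x^g` is defined. -/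
def Data.Dconj (P : Data L) (g : L) : Set L := {x | [P.inv g, x, g] ∈ P.D}

/-- Conjugation `x^g = Π(g⁻¹, x, g)`. -/
def Data.conj (P : Data L) (x g : L) : L := P.pi [P.inv g, x, g]

/-- `X^g = {x^g : x ∈ X}`. -/
def Data.conjSet (P : Data L) (X : Set L) (g : L) : Set L := (fun x => P.conj x g) '' X

/-- `W(H)`: the set of words with all entries in `H`. -/
def Wrd (H : Set L) : Set (List L) := {w | ∀ x ∈ w, x ∈ H}

/-- The centralizer `C_L(X) = {g : x ∈ D(g) and x^g = x for all x ∈ X}`. -/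
def Data.centralizer (P : Data L) (X : Set L) : Set L :=
  {g | ∀ x ∈ X, x ∈ P.Dconj g ∧ P.conj x g = x}

/-- The center `Z(L) = C_L(L)`. -/
def Data.center (P : Data L) : Set L := P.centralizer Set.univ

/-- The normalizer `N_L(X) = {g : X ⊆ D(g) and X^g = X}`. -/
def Data.normalizer (P : Data L) (X : Set L) : Set L :=
  {g | X ⊆ P.Dconj g ∧ P.conjSet X g = X}

/-- The centralizer of `X` computed inside the partial subgroup `L₀`. -/
def Data.centralizerIn (P : Data L) (L₀ X : Set L) : Set L := L₀ ∩ P.centralizer X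

/-- The center of the partial subgroup `L₀` (with its restricted partial product). -/
def Data.centerIn (P : Data L) (L₀ : Set L) : Set L := P.centralizerIn L₀ L₀

/-- The set product `XY = {Π(x,y) : x ∈ X, y ∈ Y, (x,y) ∈ D}`. -/
def Data.setMul (P : Data L) (X Y : Set L) : Set L :=
  {z | ∃ x ∈ X, ∃ y ∈ Y, [x, y] ∈ P.D ∧ P.pi [x, y] = z}

/-- `S_g = {s ∈ S ∩ D(g) : s^g ∈ S}`. -/
def Data.SOf (P : Data L) (S : Set L) (g : L) : Set L :=
  {s | s ∈ S ∧ s ∈ P.Dconj g ∧ P.conj s g ∈ S}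

/-- A partial subgroup: closed under inversion and under products of words in the domain. -/
def Data.IsPartialSubgroup (P : Data L) (H : Set L) : Prop :=
  (∀ f ∈ H, P.inv f ∈ H) ∧ ∀ w ∈ Wrd H ∩ P.D, P.pi w ∈ H

/-- A subgroup: a partial subgroup `H` with `W(H) ⊆ D`. -/
def Data.IsSubgroup (P : Data L) (H : Set L) : Prop :=
  P.IsPartialSubgroup H ∧ Wrd H ⊆ P.D

/-- A `p`-subgroup: a subgroup whose order is a power of `p`. -/
def Data.IsPSubgroup (p : ℕ) (P : Data L) (H : Set L) : Prop :=
  P.IsSubgroup H ∧ ∃ n : ℕ, H.ncard = p ^ n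

/-- A partial normal subgroup: `n^f ∈ N` for all `f ∈ L` and `n ∈ N ∩ D(f)`. -/
def Data.IsPartialNormal (P : Data L) (N : Set L) : Prop :=
  P.IsPartialSubgroup N ∧ ∀ f : L, ∀ n ∈ N, n ∈ P.Dconj f → P.conj n f ∈ N

/-- A homomorphism of partial groups: `Dβ* ⊆ D'` and `Π'(vβ*) = (Π(v))β`. -/
def IsHom (P : Data L) (P' : Data L') (β : L → L') : Prop :=
  (∀ w ∈ P.D, w.map β ∈ P'.D) ∧ ∀ w ∈ P.D, P'.pi (w.map β) = β (P.pi w)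

/-- A projection of partial groups: a homomorphism with `Dβ* = D'`. -/
def IsProjection (P : Data L) (P' : Data L') (β : L → L') : Prop :=
  IsHom P P' β ∧ ∀ w' ∈ P'.D, ∃ w ∈ P.D, w.map β = w'

/-- An isomorphism of partial groups: an injective projection. -/
def IsIsomorphism (P : Data L) (P' : Data L') (β : L → L') : Prop :=
  IsProjection P P' β ∧ Function.Injective β

/-- The kernel `ker(β) = {f : fβ = 1'}`. -/
def pgKer (P : Data L) (P' : Data L') (β : L → L') : Set L := {f | β f = P'.one}

/-- `β` restricted to the partial subgroup `L₀` is a homomorphism of partial groups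
(the source being `L₀` with the restricted product). -/
def IsHomBetween (P : Data L) (P' : Data L') (L₀ : Set L) (β : L → L') : Prop :=
  (∀ w ∈ P.D ∩ Wrd L₀, w.map β ∈ P'.D) ∧
    ∀ w ∈ P.D ∩ Wrd L₀, P'.pi (w.map β) = β (P.pi w)

/-- `β` restricted to a map `L₀ → L₀'` is a projection of partial groups between
the restricted partial groups on `L₀` and `L₀'` (so `(D ∩ W(L₀))β* = D' ∩ W(L₀')`). -/
def IsProjBetween (P : Data L) (P' : Data L') (L₀ : Set L) (L₀' : Set L') (β : L → L') :
    Prop :=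
  β '' L₀ = L₀' ∧ IsHomBetween P P' L₀ β ∧
    ∀ w' ∈ P'.D ∩ Wrd L₀', ∃ w ∈ P.D ∩ Wrd L₀, w.map β = w'

/-- `β` restricted to a map `L₀ → L₀'` is an isomorphism of partial groups. -/
def IsIsoBetween (P : Data L) (P' : Data L') (L₀ : Set L) (L₀' : Set L') (β : L → L') :
    Prop :=
  IsProjBetween P P' L₀ L₀' β ∧ Set.InjOn β L₀

/-- `chainFrom P Δ w Q` means: the word `w` lies in `D_Δ` via the chain starting at
`P₀ = Q`, i.e. there are `P₀,…,Pₙ ∈ Δ` with `P_{i-1} ⊆ D(f_i)` and `P_{i-1}^{f_i} = P_i`. -/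
def chainFrom (P : Data L) (Δ : Set (Set L)) : List L → Set L → Prop
  | [], _ => True
  | f :: w, Q => Q ⊆ P.Dconj f ∧ P.conjSet Q f ∈ Δ ∧ chainFrom P Δ w (P.conjSet Q f)

/-- The set of words `D_Δ`. -/
def DDelta (P : Data L) (Δ : Set (Set L)) : Set (List L) :=
  {w | ∃ Q ∈ Δ, chainFrom P Δ w Q}

/-- `(L,Δ,S)` is a locality (for the prime `p`). -/
structure IsLocality (p : ℕ) (P : Data L) (Δ : Set (Set L)) (S : Set L) : Prop where
  isPartialGroup : IsPartialGroup P
  /-- `L` is finite as a set. -/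
  finite : Finite L
  /-- `S` is a `p`-subgroup of `L`. -/
  pSubgroup : P.IsPSubgroup p S
  /-- `Δ` is nonempty. -/
  delta_nonempty : Δ.Nonempty
  /-- `Δ` is a set of subgroups of `S`. -/
  delta_subgroups : ∀ Q ∈ Δ, P.IsSubgroup Q ∧ Q ⊆ S
  /-- (L1): `S` is maximal among the `p`-subgroups of `L`. -/
  s_maximal : ∀ T : Set L, P.IsPSubgroup p T → S ⊆ T → T = S
  /-- (L2): `D = D_Δ`. -/
  d_eq : P.D = DDelta P Δ
  /-- (L3): overgroups in `S` of conjugates of members of `Δ` lie in `Δ`. -/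
  delta_closed : ∀ Q : Set L, P.IsSubgroup Q → Q ⊆ S →
    (∃ R ∈ Δ, ∃ g : L, R ⊆ P.Dconj g ∧ P.conjSet R g ⊆ Q) → Q ∈ Δ

/-- `(L₀,Δ,S)` is a locality, where `L₀` is a partial subgroup of the ambient partial
group and `L₀` is regarded as a partial group with the restricted product.  All the
conditions are expressed via the ambient product (with which the restricted one
agrees on words in `W(L₀)`). -/
structure IsLocalityIn (p : ℕ) (P : Data L) (L₀ : Set L) (Δ : Set (Set L)) (S : Set L) :
    Prop where
  partialSubgroup : P.IsPartialSubgroup L₀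
  /-- `L₀` is finite as a set. -/
  finite : L₀.Finite
  /-- `S` is a `p`-subgroup. -/
  pSubgroup : P.IsPSubgroup p S
  s_sub : S ⊆ L₀
  delta_nonempty : Δ.Nonempty
  delta_subgroups : ∀ Q ∈ Δ, P.IsSubgroup Q ∧ Q ⊆ S
  /-- (L1) for the restriction. -/
  s_maximal : ∀ T : Set L, T ⊆ L₀ → P.IsPSubgroup p T → S ⊆ T → T = S
  /-- (L2) for the restriction. -/
  d_eq : ∀ w ∈ Wrd L₀, (w ∈ P.D ↔ w ∈ DDelta P Δ)
  /-- (L3) for the restriction. -/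
  delta_closed : ∀ Q : Set L, P.IsSubgroup Q → Q ⊆ S →
    (∃ R ∈ Δ, ∃ g ∈ L₀, R ⊆ P.Dconj g ∧ P.conjSet R g ⊆ Q) → Q ∈ Δ

/-- `(L₀,Δ₀,S₀)` is a sublocality of a locality with Sylow subgroup `S`. -/
def IsSubLocality (p : ℕ) (P : Data L) (S : Set L) (L₀ : Set L) (Δ₀ : Set (Set L))
    (S₀ : Set L) : Prop :=
  S₀ = S ∩ L₀ ∧ IsLocalityIn p P L₀ Δ₀ S₀

/-- A projection of localities: a projection of partial groups with `Δβ = Δ'`. -/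
def IsLocalityProj (P : Data L) (P' : Data L') (Δ : Set (Set L)) (Δ' : Set (Set L'))
    (β : L → L') : Prop :=
  IsProjection P P' β ∧ Set.image β '' Δ = Δ'

/-- `β` restricted to `L₀ → L₀'` is a projection of localities. -/
def IsLocalityProjBetween (P : Data L) (P' : Data L') (L₀ : Set L) (Δ₀ : Set (Set L))
    (L₀' : Set L') (Δ₀' : Set (Set L')) (β : L → L') : Prop :=
  IsProjBetween P P' L₀ L₀' β ∧ Set.image β '' Δ₀ = Δ₀'

/-- The right coset `Nf = {Π(n,f) : n ∈ N, (n,f) ∈ D}`. -/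
def rightCoset (P : Data L) (N : Set L) (f : L) : Set L :=
  {y | ∃ n ∈ N, [n, f] ∈ P.D ∧ P.pi [n, f] = y}

/-- The data of the external direct product of two partial groups:  the domain consists
of the words whose words of first resp. second coordinates lie in the respective domains,
and the product and the inversion are computed coordinatewise. -/
def prodData (P₁ : Data L₁) (P₂ : Data L₂) : Data (L₁ × L₂) where
  D := {u | u.map Prod.fst ∈ P₁.D ∧ u.map Prod.snd ∈ P₂.D}
  pi := fun u => (P₁.pi (u.map Prod.fst), P₂.pi (u.map Prod.snd))
  inv := fun f => (P₁.inv f.1, P₂.inv f.2)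

/-- `Δ₁ * Δ₂`: the set of subgroups of `S₁ × S₂` containing some `P₁ × P₂` with
`P_i ∈ Δ_i`. -/
def deltaStar (P₁ : Data L₁) (P₂ : Data L₂) (Δ₁ : Set (Set L₁)) (Δ₂ : Set (Set L₂))
    (S₁ : Set L₁) (S₂ : Set L₂) : Set (Set (L₁ × L₂)) :=
  {Q | (prodData P₁ P₂).IsSubgroup Q ∧ Q ⊆ S₁ ×ˢ S₂ ∧
    ∃ R₁ ∈ Δ₁, ∃ R₂ ∈ Δ₂, R₁ ×ˢ R₂ ⊆ Q}

/-- `K` is a normal `p`-subgroup of the subgroup `M` of the ambient partial group. -/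
def Data.IsNormalPSubgroupIn (p : ℕ) (P : Data L) (M K : Set L) : Prop :=
  K ⊆ M ∧ P.IsSubgroup K ∧ (∃ n : ℕ, K.ncard = p ^ n) ∧
    ∀ f ∈ M, ∀ x ∈ K, x ∈ P.Dconj f ∧ P.conj x f ∈ K

/-- `O_p(M)`: the largest normal `p`-subgroup of the subgroup `M` (the union of all
normal `p`-subgroups of `M`). -/
def Data.pCoreIn (p : ℕ) (P : Data L) (M : Set L) : Set L :=
  ⋃₀ {K | P.IsNormalPSubgroupIn p M K}

/-- The subgroup `M` of the ambient partial group is of characteristic `p`: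
`C_M(O_p(M)) ≤ O_p(M)`. -/
def Data.IsCharPSubgroup (p : ℕ) (P : Data L) (M : Set L) : Prop :=
  P.centralizerIn M (P.pCoreIn p M) ⊆ P.pCoreIn p M

/-- A locality is of objective characteristic `p` if `N_L(Q)` is of characteristic `p`
for every `Q ∈ Δ`. -/
def IsObjectiveCharP (p : ℕ) (P : Data L) (Δ : Set (Set L)) : Prop :=
  ∀ Q ∈ Δ, P.IsCharPSubgroup p (P.normalizer Q)

/-- The word `(Π(f₁,g₁),…,Π(fₙ,gₙ))` built from the words `u = (f₁,…,fₙ)` and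
`v = (g₁,…,gₙ)`. -/
def zipProd (P : Data L) (u v : List L) : List L :=
  List.zipWith (fun f g => P.pi [f, g]) u v

/-- `L` is the internal central product of `M₁` and `M₂`: conditions (C1) and (C2). -/
def IsInternalCentralProduct (P : Data L) (M₁ M₂ : Set L) : Prop :=
  (P.D = {w | ∃ u v : List L, u ∈ P.D ∩ Wrd M₁ ∧ v ∈ P.D ∩ Wrd M₂ ∧
      u.length = v.length ∧ (∀ q ∈ u.zip v, [q.1, q.2] ∈ P.D) ∧ w = zipProd P u v}) ∧
  ∀ u v : List L, u ∈ P.D ∩ Wrd M₁ → v ∈ P.D ∩ Wrd M₂ → u.length = v.length →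
    (∀ q ∈ u.zip v, [q.1, q.2] ∈ P.D) →
    P.pi (zipProd P u v) = P.pi [P.pi u, P.pi v]

/-- `L` is the internal direct product of `M₁` and `M₂`: (C1), (C2) and (D). -/
def IsInternalDirectProduct (P : Data L) (M₁ M₂ : Set L) : Prop :=
  IsInternalCentralProduct P M₁ M₂ ∧
    ∀ h : L, ∃! fg : L × L, fg.1 ∈ M₁ ∧ fg.2 ∈ M₂ ∧ [fg.1, fg.2] ∈ P.D ∧
      P.pi [fg.1, fg.2] = h

/-- The binary product of a partial group. -/
def Data.mul (P : Data L) (a b : L) : L := P.pi [a, b]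

theorem Data.wInv_append (P : Data L) (u v : List L) :
    P.wInv (u ++ v) = P.wInv v ++ P.wInv u := by
  simp [Data.wInv]

namespace IsPartialGroup

variable {P : Data L} (hP : IsPartialGroup P)
include hP

theorem nil_mem (f : L) : [] ∈ P.D := hP.append_left [] [f] (hP.singleton_mem f)

theorem pi_cons {a : L} {w : List L} (h : a :: w ∈ P.D) :
    [a, P.pi w] ∈ P.D ∧ P.pi (a :: w) = P.mul a (P.pi w) := by
  have h' : [a] ++ w ++ [] ∈ P.D := by simpa using h
  exact ⟨by simpa using hP.assoc_mem _ _ _ h', by simpa [Data.mul] using hP.assoc_pi _ _ _ h'⟩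

theorem pi_pair_cons {a b : L} {w : List L} (h : a :: b :: w ∈ P.D) :
    P.mul a b :: w ∈ P.D ∧ P.pi (a :: b :: w) = P.pi (P.mul a b :: w) := by
  have h' : [] ++ [a, b] ++ w ∈ P.D := by simpa using h
  exact ⟨by simpa [Data.mul] using hP.assoc_mem _ _ _ h',
    by simpa [Data.mul] using hP.assoc_pi _ _ _ h'⟩

theorem pi_triple {a b c : L} (h : [a, b, c] ∈ P.D) :
    P.pi [a, b, c] = P.mul a (P.mul b c) ∧ P.pi [a, b, c] = P.mul (P.mul a b) c :=
  ⟨(hP.pi_cons h).2, (hP.pi_pair_cons h).2⟩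

theorem mul_assoc' {a b c : L} (h : [a, b, c] ∈ P.D) :
    P.mul (P.mul a b) c = P.mul a (P.mul b c) :=
  (hP.pi_triple h).2.symm.trans (hP.pi_triple h).1

theorem mul_one' (f : L) : [f, P.one] ∈ P.D ∧ P.mul f P.one = f := by
  have h := hP.pi_cons (w := []) (hP.singleton_mem f)
  exact ⟨h.1, h.2.symm.trans (hP.pi_singleton f)⟩

theorem insert_one {u v : List L} (h : u ++ v ∈ P.D) : u ++ [P.one] ++ v ∈ P.D :=
  hP.assoc_mem u [] v (by simpa using h)

theorem one_mul' (f : L) : P.mul P.one f = f := by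
  have h := hP.assoc_pi [] [] [f] (hP.singleton_mem f)
  exact h.symm.trans (hP.pi_singleton f)

theorem wInv_wInv (w : List L) : P.wInv (P.wInv w) = w := by
  have : P.inv ∘ P.inv = id := funext hP.inv_inv
  simp [Data.wInv, List.map_reverse, this]

theorem mem_wInv {w : List L} (h : w ∈ P.D) : P.wInv w ∈ P.D :=
  hP.append_left _ _ (hP.wInv_mem w h)

theorem wInv_append_append {u v : List L} (h : u ++ v ∈ P.D) : P.wInv u ++ u ++ v ∈ P.D := by
  have := hP.wInv_mem _ h
  rw [Data.wInv_append, List.append_assoc] at this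
  simpa using hP.append_right _ _ this

theorem append_append_wInv {u v : List L} (h : u ++ v ∈ P.D) : u ++ v ++ P.wInv v ∈ P.D := by
  have := hP.wInv_mem _ (hP.mem_wInv h)
  rw [hP.wInv_wInv, Data.wInv_append, ← List.append_assoc] at this
  exact hP.append_left _ _ this

theorem inv_mul_self (f : L) : P.mul (P.inv f) f = P.one := hP.wInv_pi [f] (hP.singleton_mem f)

theorem inv_self_mem (f : L) : [P.inv f, f] ∈ P.D := hP.wInv_mem [f] (hP.singleton_mem f)

theorem mul_inv_self (f : L) : P.mul f (P.inv f) = P.one := by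
  simpa [hP.inv_inv] using hP.inv_mul_self (P.inv f)

theorem inv_one : P.inv P.one = P.one :=
  (hP.mul_one' _).2.symm.trans (hP.inv_mul_self _)

/-- Cancellation of `a⁻¹` against `a`. -/
theorem inv_mul_cancel' {a b : L} (h : [a, b] ∈ P.D) : P.mul (P.inv a) (P.mul a b) = b := by
  have h1 : [P.inv a, a, b] ∈ P.D := hP.wInv_append_append (u := [a]) (v := [b]) h
  rw [← hP.mul_assoc' h1, hP.inv_mul_self, hP.one_mul']

theorem mul_inv_cancel' {a b : L} (h : [a, b] ∈ P.D) : P.mul (P.mul a b) (P.inv b) = a := by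
  have h1 : [a, b, P.inv b] ∈ P.D := hP.append_append_wInv (u := [a]) (v := [b]) h
  rw [hP.mul_assoc' h1, hP.mul_inv_self, (hP.mul_one' a).2]

theorem eq_inv_of_mul_eq_one {a b : L} (h : [a, b] ∈ P.D) (h1 : P.mul a b = P.one) :
    a = P.inv b := by
  rw [← hP.mul_inv_cancel' h, h1, hP.one_mul']

theorem inv_mul_rev {a b : L} (h : [a, b] ∈ P.D) :
    P.inv (P.mul a b) = P.mul (P.inv b) (P.inv a) := by
  have h1 : [P.inv b, P.inv a, a, b] ∈ P.D := hP.wInv_mem _ h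
  have h2 := hP.pi_pair_cons h1
  have h3 : [P.mul (P.inv b) (P.inv a)] ++ [a, b] ++ [] ∈ P.D := by simpa using h2.1
  have h4 : [P.mul (P.inv b) (P.inv a), P.mul a b] ∈ P.D := by
    simpa [Data.mul] using hP.assoc_mem _ _ _ h3
  symm
  refine hP.eq_inv_of_mul_eq_one h4 ?_
  rw [← hP.wInv_pi _ h]
  have h5 := hP.assoc_pi _ _ _ h3
  change _ = P.pi [P.inv b, P.inv a, a, b]
  rw [h2.2]
  simpa [Data.mul] using h5.symm

theorem conj_eq {x g : L} (h : x ∈ P.Dconj g) : P.conj x g = P.mul (P.inv g) (P.mul x g) :=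
  (hP.pi_triple h).1

theorem conj_inv {x g : L} (h : x ∈ P.Dconj g) :
    P.conj x g ∈ P.Dconj (P.inv g) ∧ P.conj (P.conj x g) (P.inv g) = x := by
  have h1 : [P.inv g, x] ++ [g] ++ [P.inv g] ∈ P.D :=
    hP.append_append_wInv (u := [P.inv g, x]) (v := [g]) h
  have h2 : [g] ++ [P.inv g, x, g] ++ [P.inv g] ∈ P.D := by
    simpa [Data.wInv, hP.inv_inv] using
      hP.wInv_append_append (u := [P.inv g]) (v := [x, g, P.inv g]) h1
  refine ⟨by simpa [Data.Dconj, hP.inv_inv, Data.conj] using hP.assoc_mem _ _ _ h2, ?_⟩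
  have h3 := hP.assoc_pi _ _ _ h2
  have h4 : P.conj (P.conj x g) (P.inv g) = P.pi [g, P.inv g, x, g, P.inv g] := by
    simpa [Data.conj, hP.inv_inv] using h3.symm
  rw [h4]
  have h5 := hP.pi_pair_cons (a := g) (b := P.inv g) (w := [x, g, P.inv g]) h2
  rw [hP.mul_inv_self] at h5
  have h6 := hP.pi_cons h5.1
  rw [h5.2, h6.2, hP.one_mul']
  have h7 : [x, g, P.inv g] ∈ P.D := hP.append_right [P.one] _ h5.1
  rw [(hP.pi_triple h7).1, hP.mul_inv_self, (hP.mul_one' x).2]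

theorem mul_conj_eq {x g : L} (h : x ∈ P.Dconj g) :
    [g, P.conj x g] ∈ P.D ∧ P.mul g (P.conj x g) = P.mul x g := by
  have h1 : [g, P.inv g, x, g] ∈ P.D := by
    simpa [Data.wInv, hP.inv_inv] using
      hP.wInv_append_append (u := [P.inv g]) (v := [x, g]) h
  have h2 := hP.pi_cons h1
  have h3 := hP.pi_pair_cons h1
  have h4 := hP.pi_cons h3.1
  refine ⟨h2.1, ?_⟩
  rw [Data.conj, ← h2.2, h3.2, h4.2, hP.mul_inv_self]
  exact hP.one_mul' _

theorem one_mem_Dconj (g : L) : P.one ∈ P.Dconj g ∧ P.conj P.one g = P.one := by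
  have h : P.one ∈ P.Dconj g := hP.insert_one (u := [P.inv g]) (v := [g]) (hP.inv_self_mem g)
  exact ⟨h, by rw [hP.conj_eq h, hP.one_mul', hP.inv_mul_self]⟩

end IsPartialGroup

/-- The weak form of partial normality in terms of binary products. -/
structure Data.IsNormalSet (P : Data L) (M : Set L) : Prop where
  one_mem : P.one ∈ M
  inv_mem : ∀ {f : L}, f ∈ M → P.inv f ∈ M
  mul_mem : ∀ {f g : L}, f ∈ M → g ∈ M → [f, g] ∈ P.D → P.mul f g ∈ M
  conj_mem : ∀ {f n : L}, n ∈ M → n ∈ P.Dconj f → P.conj n f ∈ M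

theorem Data.IsNormalSet.inter {P : Data L} {M N : Set L} (hM : P.IsNormalSet M)
    (hN : P.IsNormalSet N) : P.IsNormalSet (M ∩ N) where
  one_mem := ⟨hM.one_mem, hN.one_mem⟩
  inv_mem h := ⟨hM.inv_mem h.1, hN.inv_mem h.2⟩
  mul_mem hf hg h := ⟨hM.mul_mem hf.1 hg.1 h, hN.mul_mem hf.2 hg.2 h⟩
  conj_mem hn h := ⟨hM.conj_mem hn.1 h, hN.conj_mem hn.2 h⟩

theorem Data.isNormalSet_univ {P : Data L} : P.IsNormalSet Set.univ := by
  constructor <;> simp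

theorem Data.IsPartialNormal.isNormalSet {P : Data L} (hP : IsPartialGroup P) [Nonempty L]
    {N : Set L} (hN : P.IsPartialNormal N) : P.IsNormalSet N where
  one_mem := hN.1.2 [] ⟨by simp [Wrd], hP.nil_mem (Classical.arbitrary L)⟩
  inv_mem := hN.1.1 _
  mul_mem hf hg h := hN.1.2 _ ⟨by simp [Wrd, hf, hg], h⟩
  conj_mem hn h := hN.2 _ _ hn h

/-- A set closed under binary products is closed under all products. -/
theorem IsPartialGroup.pi_mem {P : Data L} (hP : IsPartialGroup P) {H : Set L}
    (one_mem : P.one ∈ H)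
    (mul_mem : ∀ f ∈ H, ∀ g ∈ H, [f, g] ∈ P.D → P.mul f g ∈ H) :
    ∀ w ∈ Wrd H ∩ P.D, P.pi w ∈ H := by
  rintro w ⟨hw, hD⟩
  induction w with
  | nil => exact one_mem
  | cons a w ih =>
    have h := hP.pi_cons hD
    rw [h.2]
    have hw' : w ∈ Wrd H := fun x hx => hw x (List.mem_cons_of_mem _ hx)
    exact mul_mem a (hw a List.mem_cons_self) _ (ih hw' (hP.append_right [a] w hD)) h.1

namespace IsHom

variable {P : Data L} {P' : Data L'} {β : L → L'} (hβ : IsHom P P' β)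
include hβ

theorem map_one (f : L) (hP : IsPartialGroup P) : β P.one = P'.one :=
  (hβ.2 [] (hP.nil_mem f)).symm

theorem map_mul {a b : L} (h : [a, b] ∈ P.D) :
    [β a, β b] ∈ P'.D ∧ β (P.mul a b) = P'.mul (β a) (β b) :=
  ⟨hβ.1 _ h, (hβ.2 _ h).symm⟩

theorem mul_congr {a b c d : L} (h : [a, b] ∈ P.D) (h' : [c, d] ∈ P.D) (hac : β a = β c)
    (hbd : β b = β d) : β (P.mul a b) = β (P.mul c d) := by
  rw [(hβ.map_mul h).2, (hβ.map_mul h').2, hac, hbd]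

theorem map_inv (hP : IsPartialGroup P) (hP' : IsPartialGroup P') (a : L) :
    β (P.inv a) = P'.inv (β a) := by
  have h := hβ.map_mul (hP.inv_self_mem a)
  refine hP'.eq_inv_of_mul_eq_one h.1 ?_
  rw [← h.2, hP.inv_mul_self, hβ.map_one a hP]

theorem isNormalSet_ker [Nonempty L] (hP : IsPartialGroup P) (hP' : IsPartialGroup P') :
    P.IsNormalSet (pgKer P P' β) where
  one_mem := hβ.map_one (Classical.arbitrary L) hP
  inv_mem {f} h := by
    change β f = _ at h
    change β (P.inv f) = _
    rw [hβ.map_inv hP hP', h, hP'.inv_one]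
  mul_mem {f g} hf hg h := by
    change β f = _ at hf
    change β g = _ at hg
    change β (P.mul f g) = _
    rw [(hβ.map_mul h).2, hf, hg, hP'.one_mul']
  conj_mem {f n} hn h := by
    change β n = _ at hn
    change β (P.conj n f) = _
    have h1 := (hβ.map_mul (hP.pi_cons h).1).2
    change β (P.mul _ (P.mul n f)) = P'.mul _ (β (P.mul n f)) at h1
    rw [hP.conj_eq h, h1, (hβ.map_mul (hP.append_right [P.inv f] [n, f] h)).2, hn, hP'.one_mul',
      ← (hβ.map_mul (hP.inv_self_mem f)).2, hP.inv_mul_self, hβ.map_one f hP]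

end IsHom

/-- `Step P Δ Q f R`: the sets `Q` and `R` are objects, `Q ⊆ D(f)` and `Q^f = R`. -/
structure Step (P : Data L) (Δ : Set (Set L)) (Q : Set L) (f : L) (R : Set L) : Prop where
  left : Q ∈ Δ
  right : R ∈ Δ
  sub : Q ⊆ P.Dconj f
  eq : P.conjSet Q f = R

theorem IsPartialGroup.isSubgroup_of_subset {P : Data L} (hP : IsPartialGroup P) {S H : Set L}
    (hS : P.IsSubgroup S) (hHS : H ⊆ S) (one_mem : P.one ∈ H) (inv_mem : ∀ f ∈ H, P.inv f ∈ H)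
    (mul_mem : ∀ f ∈ H, ∀ g ∈ H, P.mul f g ∈ H) : P.IsSubgroup H :=
  ⟨⟨inv_mem, hP.pi_mem one_mem fun f hf g hg _ => mul_mem f hf g hg⟩,
    fun w hw => hS.2 fun x hx => hHS (hw x hx)⟩

namespace Data.IsSubgroup

variable {P : Data L} {H : Set L} (hH : P.IsSubgroup H)
include hH

theorem word_mem {w : List L} (hw : ∀ x ∈ w, x ∈ H) : w ∈ P.D := hH.2 hw

theorem inv_mem {x : L} (hx : x ∈ H) : P.inv x ∈ H := hH.1.1 x hx

theorem one_mem : P.one ∈ H := hH.1.2 [] ⟨by simp [Wrd], hH.word_mem (by simp)⟩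

theorem pair_mem {x y : L} (hx : x ∈ H) (hy : y ∈ H) : [x, y] ∈ P.D :=
  hH.word_mem (by simp [hx, hy])

theorem mul_mem {x y : L} (hx : x ∈ H) (hy : y ∈ H) : P.mul x y ∈ H :=
  hH.1.2 _ ⟨by simp [Wrd, hx, hy], hH.pair_mem hx hy⟩

theorem mem_Dconj {x y : L} (hx : x ∈ H) (hy : y ∈ H) : x ∈ P.Dconj y :=
  hH.word_mem (by simp [hx, hy, hH.inv_mem])

theorem conj_mem {x y : L} (hx : x ∈ H) (hy : y ∈ H) : P.conj x y ∈ H :=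
  hH.1.2 _ ⟨by simp [Wrd, hx, hy, hH.inv_mem], hH.mem_Dconj hx hy⟩

theorem conjSet_self (hP : IsPartialGroup P) {x : L} (hx : x ∈ H) : P.conjSet H x = H := by
  ext y
  constructor
  · rintro ⟨z, hz, rfl⟩
    exact hH.conj_mem hz hx
  · intro hy
    refine ⟨P.conj y (P.inv x), hH.conj_mem hy (hH.inv_mem hx), ?_⟩
    simpa [hP.inv_inv] using (hP.conj_inv (hH.mem_Dconj hy (hH.inv_mem hx))).2

end Data.IsSubgroup

namespace IsLocality

variable {p : ℕ} {P : Data L} {Δ : Set (Set L)} {S : Set L} (h : IsLocality p P Δ S)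
include h

theorem isSubgroup : P.IsSubgroup S := h.pSubgroup.1

theorem subset_S {Q : Set L} (hQ : Q ∈ Δ) : Q ⊆ S := (h.delta_subgroups Q hQ).2

theorem isSubgroup_obj {Q : Set L} (hQ : Q ∈ Δ) : P.IsSubgroup Q := (h.delta_subgroups Q hQ).1

theorem conj_one (x : L) : x ∈ P.Dconj P.one ∧ P.conj x P.one = x := by
  have hP := h.isPartialGroup
  have h1 : [P.inv P.one, x, P.one] ∈ P.D := by
    rw [hP.inv_one]
    exact hP.insert_one (u := [P.one, x]) (v := [])
      (hP.insert_one (u := []) (v := [x]) (hP.singleton_mem x))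
  exact ⟨h1, by rw [hP.conj_eq h1, hP.inv_one, hP.one_mul', (hP.mul_one' x).2]⟩

theorem conjSet_one (Q : Set L) : P.conjSet Q P.one = Q := by
  simp [Data.conjSet, (h.conj_one _).2]

theorem step_one {Q : Set L} (hQ : Q ∈ Δ) : Step P Δ Q P.one Q :=
  ⟨hQ, hQ, fun x _ => (h.conj_one x).1, h.conjSet_one Q⟩

theorem obj_of_superset {Q R : Set L} (hQ : Q ∈ Δ) (hR : P.IsSubgroup R) (hQR : Q ⊆ R)
    (hRS : R ⊆ S) : R ∈ Δ :=
  h.delta_closed R hR hRS ⟨Q, hQ, P.one, (h.step_one hQ).sub, by rwa [h.conjSet_one]⟩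

theorem S_mem : S ∈ Δ :=
  let ⟨_, hQ⟩ := h.delta_nonempty
  h.obj_of_superset hQ h.isSubgroup (h.subset_S hQ) subset_rfl

theorem step_self {Q : Set L} (hQ : Q ∈ Δ) {x : L} (hx : x ∈ Q) : Step P Δ Q x Q :=
  ⟨hQ, hQ, fun _ hy => (h.isSubgroup_obj hQ).mem_Dconj hy hx,
    (h.isSubgroup_obj hQ).conjSet_self h.isPartialGroup hx⟩

theorem word_mem_D {w : List L} {Q : Set L} (hQ : Q ∈ Δ) (hw : chainFrom P Δ w Q) :
    w ∈ P.D := by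
  rw [h.d_eq]
  exact ⟨Q, hQ, hw⟩

end IsLocality

theorem Step.chainFrom_cons {P : Data L} {Δ : Set (Set L)} {Q R : Set L} {f : L} {w : List L}
    (hf : Step P Δ Q f R) (hw : chainFrom P Δ w R) : chainFrom P Δ (f :: w) Q :=
  ⟨hf.sub, by rw [hf.eq]; exact hf.right, by rw [hf.eq]; exact hw⟩

theorem Step.of_chainFrom_cons {P : Data L} {Δ : Set (Set L)} {Q : Set L} {f : L} {w : List L}
    (hQ : Q ∈ Δ) (hw : chainFrom P Δ (f :: w) Q) :
    ∃ R, Step P Δ Q f R ∧ chainFrom P Δ w R :=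
  ⟨_, ⟨hQ, hw.2.1, hw.1, rfl⟩, hw.2.2⟩

namespace IsLocality

variable {p : ℕ} {P : Data L} {Δ : Set (Set L)} {S : Set L} (h : IsLocality p P Δ S)
  {Q R U V W : Set L} {f g k l : L}
include h

theorem exists_step (f : L) : ∃ Q R, Step P Δ Q f R := by
  have hf := h.isPartialGroup.singleton_mem f
  rw [h.d_eq] at hf
  obtain ⟨Q, hQ, hw⟩ := hf
  obtain ⟨R, h1, -⟩ := Step.of_chainFrom_cons hQ hw
  exact ⟨Q, R, h1⟩

theorem exists_step₂ (hD : [f, g] ∈ P.D) :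
    ∃ Q R U, Step P Δ Q f R ∧ Step P Δ R g U := by
  rw [h.d_eq] at hD
  obtain ⟨Q, hQ, hw⟩ := hD
  obtain ⟨R, h1, hw⟩ := Step.of_chainFrom_cons hQ hw
  obtain ⟨U, h2, -⟩ := Step.of_chainFrom_cons h1.right hw
  exact ⟨Q, R, U, h1, h2⟩

theorem exists_step₃ (hD : [f, g, k] ∈ P.D) :
    ∃ Q R U V, Step P Δ Q f R ∧ Step P Δ R g U ∧ Step P Δ U k V := by
  rw [h.d_eq] at hD
  obtain ⟨Q, hQ, hw⟩ := hD
  obtain ⟨R, h1, hw⟩ := Step.of_chainFrom_cons hQ hw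
  obtain ⟨U, h2, hw⟩ := Step.of_chainFrom_cons h1.right hw
  obtain ⟨V, h3, -⟩ := Step.of_chainFrom_cons h2.right hw
  exact ⟨Q, R, U, V, h1, h2, h3⟩

theorem mem_D₂ (h1 : Step P Δ Q f R) (h2 : Step P Δ R g U) : [f, g] ∈ P.D :=
  h.word_mem_D h1.left (h1.chainFrom_cons (h2.chainFrom_cons trivial))

theorem mem_D₃ (h1 : Step P Δ Q f R) (h2 : Step P Δ R g U) (h3 : Step P Δ U k V) :
    [f, g, k] ∈ P.D :=
  h.word_mem_D h1.left (h1.chainFrom_cons (h2.chainFrom_cons (h3.chainFrom_cons trivial)))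

theorem step_inv (h1 : Step P Δ Q f R) : Step P Δ R (P.inv f) Q := by
  have hP := h.isPartialGroup
  refine ⟨h1.right, h1.left, ?_, ?_⟩
  · rw [← h1.eq]
    rintro _ ⟨x, hx, rfl⟩
    exact (hP.conj_inv (h1.sub hx)).1
  · rw [← h1.eq]
    ext x
    constructor
    · rintro ⟨_, ⟨y, hy, rfl⟩, rfl⟩
      change P.conj (P.conj y f) _ ∈ _
      rwa [(hP.conj_inv (h1.sub hy)).2]
    · exact fun hx => ⟨_, ⟨x, hx, rfl⟩, (hP.conj_inv (h1.sub hx)).2⟩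

/-- Conjugation by a product along composable steps. -/
theorem conj_mul_of_mem {x : L} (hD : [P.inv g, P.inv f, x, f, g] ∈ P.D) :
    x ∈ P.Dconj (P.mul f g) ∧ P.conj x (P.mul f g) = P.conj (P.conj x f) g := by
  have hP := h.isPartialGroup
  have h1 : [P.inv g, P.inv f, x] ++ [f, g] ++ [] ∈ P.D := by simpa using hD
  have h2 : [P.inv g, P.inv f, x, P.mul f g] ∈ P.D := by
    simpa [Data.mul] using hP.assoc_mem _ _ _ h1
  have h3 : P.pi [P.inv g, P.inv f, x, f, g] = P.pi [P.inv g, P.inv f, x, P.mul f g] := by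
    simpa [Data.mul] using hP.assoc_pi _ _ _ h1
  have h4 := hP.pi_pair_cons h2
  have hfg : [f, g] ∈ P.D := hP.append_right [P.inv g, P.inv f, x] [f, g] hD
  rw [← hP.inv_mul_rev hfg] at h4
  refine ⟨h4.1, ?_⟩
  have h5 : [P.inv g] ++ [P.inv f, x, f] ++ [g] ∈ P.D := hD
  have h6 := hP.assoc_pi _ _ _ h5
  calc P.conj x (P.mul f g) = P.pi [P.inv g, P.inv f, x, P.mul f g] := h4.2.symm
    _ = P.pi [P.inv g, P.inv f, x, f, g] := h3.symm
    _ = _ := h6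

theorem step_mul (h1 : Step P Δ Q f R) (h2 : Step P Δ R g U) : Step P Δ Q (P.mul f g) U := by
  have key : ∀ x ∈ Q, x ∈ P.Dconj (P.mul f g) ∧
      P.conj x (P.mul f g) = P.conj (P.conj x f) g := by
    intro x hx
    apply h.conj_mul_of_mem
    exact h.word_mem_D h2.right ((h.step_inv h2).chainFrom_cons ((h.step_inv h1).chainFrom_cons
      ((h.step_self h1.left hx).chainFrom_cons (h1.chainFrom_cons (h2.chainFrom_cons trivial)))))
  refine ⟨h1.left, h2.right, fun x hx => (key x hx).1, ?_⟩
  rw [← h2.eq, ← h1.eq, Data.conjSet, Data.conjSet, Data.conjSet, Set.image_image]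
  exact Set.image_congr fun x hx => (key x hx).2

end IsLocality

theorem Step.conj_mem {P : Data L} {Δ : Set (Set L)} {Q R : Set L} {f x : L}
    (s : Step P Δ Q f R) (hx : x ∈ Q) : P.conj x f ∈ R := by
  rw [← s.eq]
  exact ⟨x, hx, rfl⟩

theorem Step.mono {P : Data L} {Δ : Set (Set L)} {Q R Q' R' : Set L} {f : L}
    (s : Step P Δ Q f R) (t : Step P Δ Q' f R') (hQ : Q ⊆ Q') : R ⊆ R' := by
  rw [← s.eq, ← t.eq]
  exact Set.image_mono hQ

namespace IsLocality

open CategoryTheory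

variable {p : ℕ} {P : Data L} {Δ : Set (Set L)} {S : Set L} (h : IsLocality p P Δ S)
  {Q R U V W : Set L} {f g k l : L}

/-- The objects of the groupoid whose morphisms are the steps of the locality. -/
@[ext]
structure Obj (_ : IsLocality p P Δ S) where
  /-- The underlying set. -/
  carrier : Set L
  mem : carrier ∈ Δ

instance : Groupoid h.Obj where
  Hom Q R := {f : L // Step P Δ Q.carrier f R.carrier}
  id Q := ⟨P.one, h.step_one Q.mem⟩
  comp f g := ⟨P.mul f.1 g.1, h.step_mul f.2 g.2⟩
  inv f := ⟨P.inv f.1, h.step_inv f.2⟩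
  id_comp f := Subtype.ext (h.isPartialGroup.one_mul' f.1)
  comp_id f := Subtype.ext (h.isPartialGroup.mul_one' f.1).2
  assoc f g k := Subtype.ext (h.isPartialGroup.mul_assoc' (h.mem_D₃ f.2 g.2 k.2))
  inv_comp f := Subtype.ext (h.isPartialGroup.inv_mul_self f.1)
  comp_inv f := Subtype.ext (h.isPartialGroup.mul_inv_self f.1)

section Hom

variable {h}

theorem comp_val {X Y Z : h.Obj} (f : X ⟶ Y) (g : Y ⟶ Z) : (f ≫ g).1 = P.mul f.1 g.1 := rfl

theorem inv_val {X Y : h.Obj} (f : X ⟶ Y) : (Groupoid.inv f).1 = P.inv f.1 := rfl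

theorem conj_val' {X X' Y Y' : h.Obj} (f : X ⟶ Y) (n : X ⟶ X') (f' : X' ⟶ Y') (hf : f'.1 = f.1) :
    n.1 ∈ P.Dconj f.1 ∧ (Groupoid.inv f ≫ n ≫ f').1 = P.conj n.1 f.1 := by
  have hD : n.1 ∈ P.Dconj f.1 := h.mem_D₃ (h.step_inv f.2) n.2 (hf ▸ f'.2)
  exact ⟨hD, by rw [h.isPartialGroup.conj_eq hD, comp_val, comp_val, inv_val, hf]⟩

theorem conj_val {X Y : h.Obj} (n : X ⟶ X) (f : X ⟶ Y) :
    (Groupoid.inv f ≫ n ≫ f).1 = P.conj n.1 f.1 :=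
  (conj_val' f n f rfl).2

end Hom

/-- A step, as a morphism of the groupoid. -/
def hom (s : Step P Δ Q f R) : (⟨Q, s.left⟩ : h.Obj) ⟶ ⟨R, s.right⟩ := ⟨f, s⟩

include h

theorem conj_mul_of_step (s : Step P Δ Q f R) {x y : L} (hx : Step P Δ Q x Q)
    (hy : Step P Δ Q y Q) : P.conj (P.mul x y) f = P.mul (P.conj x f) (P.conj y f) := by
  have := congrArg Subtype.val (show Groupoid.inv (h.hom s) ≫ (h.hom hx ≫ h.hom hy) ≫ h.hom s
    = (Groupoid.inv (h.hom s) ≫ h.hom hx ≫ h.hom s) ≫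
      (Groupoid.inv (h.hom s) ≫ h.hom hy ≫ h.hom s) by simp)
  rwa [conj_val, comp_val, comp_val, conj_val, conj_val] at this

theorem conj_inv_of_step (s : Step P Δ Q f R) {x : L} (hx : Step P Δ Q x Q) :
    P.conj (P.inv x) f = P.inv (P.conj x f) := by
  have := congrArg Subtype.val (show Groupoid.inv (h.hom s) ≫ (Groupoid.inv (h.hom hx)) ≫ h.hom s
    = Groupoid.inv (Groupoid.inv (h.hom s) ≫ h.hom hx ≫ h.hom s) by simp)
  rwa [conj_val, inv_val, inv_val, conj_val] at this

theorem conj_injOn (s : Step P Δ Q f R) : Set.InjOn (fun x => P.conj x f) Q := by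
  intro x hx y hy hxy
  have hP := h.isPartialGroup
  rw [← (hP.conj_inv (s.sub hx)).2, ← (hP.conj_inv (s.sub hy)).2]
  exact congrArg (fun z => P.conj z (P.inv f)) hxy

theorem step_mono (s : Step P Δ Q f R) {Q₁ : Set L} (hQ₁ : Q₁ ∈ Δ) (hQ : Q₁ ⊆ Q) :
    Step P Δ Q₁ f (P.conjSet Q₁ f) := by
  have hsub : P.conjSet Q₁ f ⊆ R := by
    rw [← s.eq]
    exact Set.image_mono hQ
  have hQ₁' := h.isSubgroup_obj hQ₁
  have hst {x : L} (hx : x ∈ Q₁) := h.step_self s.left (hQ hx)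
  have hgrp : P.IsSubgroup (P.conjSet Q₁ f) := by
    refine h.isPartialGroup.isSubgroup_of_subset (h.isSubgroup_obj s.right) hsub ?_ ?_ ?_
    · exact ⟨P.one, hQ₁'.one_mem, (h.isPartialGroup.one_mem_Dconj f).2⟩
    · rintro _ ⟨x, hx, rfl⟩
      exact ⟨P.inv x, hQ₁'.inv_mem hx, h.conj_inv_of_step s (hst hx)⟩
    · rintro _ ⟨x, hx, rfl⟩ _ ⟨y, hy, rfl⟩
      exact ⟨P.mul x y, hQ₁'.mul_mem hx hy, h.conj_mul_of_step s (hst hx) (hst hy)⟩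
  exact ⟨hQ₁, h.delta_closed _ hgrp (hsub.trans (h.subset_S s.right))
    ⟨Q₁, hQ₁, f, hQ.trans s.sub, subset_rfl⟩, hQ.trans s.sub, rfl⟩

theorem step_of_mem_S (hQ : Q ∈ Δ) {x : L} (hx : x ∈ S) : Step P Δ Q x (P.conjSet Q x) :=
  h.step_mono (h.step_self h.S_mem hx) hQ (h.subset_S hQ)

/-- If `x` and `x^f` lie in `S`, then a step along `f` can be moved by `x`. -/
theorem step_conj {x : L} (s : Step P Δ Q f R) (hx : x ∈ P.SOf S f) :
    Step P Δ (P.conjSet Q x) f (P.conjSet R (P.conj x f)) := by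
  have hP := h.isPartialGroup
  have hxQ := h.step_of_mem_S s.left hx.1
  have hfR := h.step_of_mem_S s.right hx.2.2
  have h1 := h.step_mul (h.step_inv hxQ) (h.step_mul s hfR)
  have h2 : P.mul (P.inv x) (P.mul f (P.conj x f)) = f := by
    rw [(hP.mul_conj_eq hx.2.1).2]
    exact hP.inv_mul_cancel' (hP.append_right [P.inv f] [x, f] hx.2.1)
  rwa [h2] at h1

theorem mem_SOf_of_step (s : Step P Δ Q f R) : Q ⊆ P.SOf S f := fun _ hx =>
  ⟨h.subset_S s.left hx, s.sub hx, h.subset_S s.right (s.conj_mem hx)⟩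

end IsLocality

namespace IsLocality

open CategoryTheory

variable {p : ℕ} {P : Data L} {Δ : Set (Set L)} {S : Set L} (h : IsLocality p P Δ S)
  {Q R U V W : Set L} {f g k l : L}
include h

theorem conj_mul_of_mem_SOf {x y : L} (hx : x ∈ P.SOf S f) (hy : y ∈ P.SOf S f) :
    P.mul x y ∈ P.SOf S f ∧ P.conj (P.mul x y) f = P.mul (P.conj x f) (P.conj y f) := by
  obtain ⟨Q, R, s⟩ := h.exists_step f
  have s₁ := h.step_conj s hx
  have s₂ := h.step_conj s₁ hy
  let X := h.hom (h.step_of_mem_S s.left hx.1)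
  let Y := h.hom (h.step_of_mem_S s₁.left hy.1)
  have e := conj_val' (h.hom s) (X ≫ Y) (h.hom s₂) rfl
  have e₁ := conj_val' (h.hom s) X (h.hom s₁) rfl
  have e₂ := conj_val' (h.hom s₁) Y (h.hom s₂) rfl
  have key : P.conj (P.mul x y) f = P.mul (P.conj x f) (P.conj y f) := by
    refine e.2.symm.trans (Eq.trans ?_ (congrArg₂ P.mul e₁.2 e₂.2))
    rw [← comp_val]
    simp
  refine ⟨⟨h.isSubgroup.mul_mem hx.1 hy.1, e.1, ?_⟩, key⟩
  rw [key]
  exact h.isSubgroup.mul_mem hx.2.2 hy.2.2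

theorem conj_inv_of_mem_SOf {x : L} (hx : x ∈ P.SOf S f) :
    P.inv x ∈ P.SOf S f ∧ P.conj (P.inv x) f = P.inv (P.conj x f) := by
  obtain ⟨Q, R, s⟩ := h.exists_step f
  have s₁ := h.step_conj s hx
  let X := h.hom (h.step_of_mem_S s.left hx.1)
  have e := conj_val' (h.hom s₁) (Groupoid.inv X) (h.hom s) rfl
  have e₁ := conj_val' (h.hom s) X (h.hom s₁) rfl
  have key : P.conj (P.inv x) f = P.inv (P.conj x f) := by
    refine e.2.symm.trans (Eq.trans ?_ (congrArg P.inv e₁.2))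
    rw [← inv_val]
    simp
  refine ⟨⟨h.isSubgroup.inv_mem hx.1, e.1, ?_⟩, key⟩
  rw [key]
  exact h.isSubgroup.inv_mem hx.2.2

theorem step_SOf (f : L) : Step P Δ (P.SOf S f) f (P.conjSet (P.SOf S f) f) := by
  have hP := h.isPartialGroup
  obtain ⟨Q, R, s⟩ := h.exists_step f
  have hone : P.one ∈ P.SOf S f := h.mem_SOf_of_step s (h.isSubgroup_obj s.left).one_mem
  have h1 : P.IsSubgroup (P.SOf S f) :=
    hP.isSubgroup_of_subset h.isSubgroup (fun _ hx => hx.1) hone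
      (fun x hx => (h.conj_inv_of_mem_SOf hx).1)
      (fun x hx y hy => (h.conj_mul_of_mem_SOf hx hy).1)
  have h2 : P.SOf S f ∈ Δ := h.obj_of_superset s.left h1 (h.mem_SOf_of_step s) fun _ hx => hx.1
  have hsub : P.conjSet (P.SOf S f) f ⊆ S := by
    rintro _ ⟨x, hx, rfl⟩
    exact hx.2.2
  have h3 : P.IsSubgroup (P.conjSet (P.SOf S f) f) := by
    refine hP.isSubgroup_of_subset h.isSubgroup hsub ⟨_, hone, (hP.one_mem_Dconj f).2⟩ ?_ ?_
    · rintro _ ⟨x, hx, rfl⟩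
      exact ⟨_, (h.conj_inv_of_mem_SOf hx).1, (h.conj_inv_of_mem_SOf hx).2⟩
    · rintro _ ⟨x, hx, rfl⟩ _ ⟨y, hy, rfl⟩
      exact ⟨_, (h.conj_mul_of_mem_SOf hx hy).1, (h.conj_mul_of_mem_SOf hx hy).2⟩
  exact ⟨h2, h.delta_closed _ h3 hsub ⟨_, h2, f, fun _ hx => hx.2.1, subset_rfl⟩,
    fun _ hx => hx.2.1, rfl⟩

theorem step_of_subset_SOf (hQ : Q ∈ Δ) (hf : Q ⊆ P.SOf S f) :
    Step P Δ Q f (P.conjSet Q f) :=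
  h.step_mono (h.step_SOf f) hQ hf

theorem mem_SOf_mul {x : L} (hD : [f, g] ∈ P.D) (hf : x ∈ P.SOf S f)
    (hg : P.conj x f ∈ P.SOf S g) : x ∈ P.SOf S (P.mul f g) ∧
      P.conj x (P.mul f g) = P.conj (P.conj x f) g := by
  obtain ⟨Q, R, U, s, t⟩ := h.exists_step₂ hD
  have s' := h.step_conj s hf
  have t' := h.step_conj t hg
  have key := h.conj_mul_of_mem (x := x) (h.word_mem_D t.right ((h.step_inv t).chainFrom_cons
    ((h.step_inv s).chainFrom_cons ((h.step_of_mem_S s.left hf.1).chainFrom_cons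
      (s'.chainFrom_cons (t'.chainFrom_cons trivial))))))
  exact ⟨⟨hf.1, key.1, key.2 ▸ hg.2.2⟩, key.2⟩

theorem conj_mem_SOf_inv {x : L} (hx : x ∈ P.SOf S f) : P.conj x f ∈ P.SOf S (P.inv f) :=
  have e := h.isPartialGroup.conj_inv hx.2.1
  ⟨hx.2.2, e.1, e.2.symm ▸ hx.1⟩

/-- A step along an element of a normal set `M` stays inside an object containing `S ∩ M`. -/
theorem subset_of_step_normal {M : Set L} (hM : P.IsNormalSet M) {m : L} (hm : m ∈ M)
    (hU : U ∈ Δ) (hMU : S ∩ M ⊆ U) (s : Step P Δ Q m R) (hQ : Q ⊆ U) : R ⊆ U := by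
  have hP := h.isPartialGroup
  rw [← s.eq]
  rintro _ ⟨q, hq, rfl⟩
  change P.conj q m ∈ U
  have hqS := h.subset_S s.left hq
  have hqmS := h.subset_S s.right (s.conj_mem hq)
  let X := h.hom (h.step_self s.left hq)
  let Y := h.hom s
  let Z := h.hom (h.step_of_mem_S s.right hqS)
  have e := conj_val' Z (Groupoid.inv Y) X rfl
  have e' := conj_val X Y
  have key : P.mul (P.conj (P.inv m) q) m = P.mul (P.inv q) (P.conj q m) := by
    refine (congrArg (P.mul · m) e.2.symm).trans (Eq.trans ?_ (congrArg (P.mul (P.inv q)) e'))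
    change ((Groupoid.inv Z ≫ Groupoid.inv Y ≫ X) ≫ Y).1 =
      (Groupoid.inv Z ≫ Groupoid.inv Y ≫ X ≫ Y).1
    simp
  have hD : [P.conj (P.inv m) q, m] ∈ P.D := by
    have := h.mem_D₂ (Groupoid.inv Z ≫ Groupoid.inv Y ≫ X).2 Y.2
    rwa [e.2] at this
  have hmem : P.mul (P.inv q) (P.conj q m) ∈ S ∩ M := by
    refine ⟨h.isSubgroup.mul_mem (h.isSubgroup.inv_mem hqS) hqmS, ?_⟩
    rw [← key]
    exact hM.mul_mem (hM.conj_mem (hM.inv_mem hm) e.1) hm hD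
  have := (h.isSubgroup_obj hU).mul_mem (hQ hq) (hMU hmem)
  have e3 := hP.inv_mul_cancel'
    (h.isSubgroup.pair_mem (h.isSubgroup.inv_mem hqS) hqmS)
  rw [hP.inv_inv] at e3
  rwa [e3] at this

theorem ncard_eq_of_step (s : Step P Δ Q f R) : R.ncard = Q.ncard := by
  rw [← s.eq]
  exact (h.conj_injOn s).ncard_image

end IsLocality

section FiniteGroup

variable {G : Type*} [Group G] {p : ℕ}

/-- Normalizers grow in a finite `p`-group. -/
theorem _root_.IsPGroup.exists_mem_normalizing [hp : Fact p.Prime] {A C : Subgroup G} [Finite C]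
    (hC : IsPGroup p C) (hAC : A < C) :
    ∃ x ∈ C, x ∉ A ∧ ∀ a, a ∈ A ↔ x * a * x⁻¹ ∈ A := by
  have := hC.isNilpotent
  have hlt : A.subgroupOf C < ⊤ := by
    rw [lt_top_iff_ne_top, Ne, Subgroup.subgroupOf_eq_top]
    exact not_le_of_gt hAC
  obtain ⟨x, hx, hxA⟩ := SetLike.exists_of_lt (Group.normalizerCondition_of_isNilpotent _ hlt)
  refine ⟨x, x.2, fun hA => hxA hA, ?_⟩
  rw [Subgroup.mem_normalizer_iff] at hx
  intro a
  constructor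
  · intro ha
    exact (hx ⟨a, hAC.le ha⟩).1 ha
  · intro ha
    have : (x : G)⁻¹ * (x * a * (x : G)⁻¹) * x ∈ C :=
      mul_mem (mul_mem (inv_mem x.2) (hAC.le ha)) x.2
    have ha' : a ∈ C := by simpa [mul_assoc] using this
    exact (hx ⟨a, ha'⟩).2 ha

theorem _root_.IsPGroup.exists_mem_normal_normalizing [hp : Fact p.Prime] {A B : Subgroup G}
    [Finite G] (hG : IsPGroup p G) [hB : B.Normal] (hBA : ¬ B ≤ A) :
    ∃ x ∈ B, x ∉ A ∧ ∀ a, a ∈ A ↔ x * a * x⁻¹ ∈ A := by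
  have hlt : A < A ⊔ B := left_lt_sup.2 hBA
  obtain ⟨x, hx, hxA, hn⟩ := (hG.to_subgroup (A ⊔ B)).exists_mem_normalizing hlt
  rw [Subgroup.mem_sup_of_normal_right] at hx
  obtain ⟨a, ha, b, hb, rfl⟩ := hx
  refine ⟨b, hb, fun h => hxA (mul_mem ha h), fun c => (hn c).trans ?_⟩
  have : a * b * c * (a * b)⁻¹ = a * (b * c * b⁻¹) * a⁻¹ := by group
  rw [this, Subgroup.mul_mem_cancel_right _ (inv_mem ha), Subgroup.mul_mem_cancel_left _ ha]

/-- A version of Sylow's theorem inside `AB`, for `A` a Sylow subgroup of `AB` and `B` normal. -/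
theorem _root_.IsPGroup.exists_conj_mem [hp : Fact p.Prime] [Finite G] {A B J : Subgroup G}
    (hA : IsPGroup p A) [hB : B.Normal]
    (hmax : ∀ C : Subgroup G, IsPGroup p C → A ≤ C → C ≤ A ⊔ B → C ≤ A)
    (hJ : IsPGroup p J) (hJAB : J ≤ A ⊔ B) : ∃ b ∈ B, ∀ j ∈ J, b⁻¹ * j * b ∈ A := by
  let T : Sylow p ↥(A ⊔ B) :=
    { toSubgroup := A.subgroupOf (A ⊔ B)
      isPGroup' := hA.comap_subtype
      is_maximal' := by
        intro Q hQ hle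
        refine le_antisymm ?_ hle
        have h1 : A ≤ Q.map (A ⊔ B).subtype := by
          intro a ha
          exact ⟨⟨a, le_sup_left (b := B) ha⟩, hle ha, rfl⟩
        have h2 := hmax _ (hQ.map _) h1 (Subgroup.map_subtype_le Q)
        intro q hq
        exact h2 ⟨q, hq, rfl⟩ }
  have hJ' : IsPGroup p (J.subgroupOf (A ⊔ B)) := hJ.comap_subtype
  obtain ⟨Q, hQ⟩ := hJ'.exists_le_sylow
  obtain ⟨g, hg⟩ := MulAction.exists_smul_eq ↥(A ⊔ B) T Q
  obtain ⟨g, hgm⟩ := g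
  have hgm' := hgm
  rw [sup_comm, Subgroup.mem_sup_of_normal_left] at hgm'
  obtain ⟨b, hb, a, ha, rfl⟩ := hgm'
  refine ⟨b, hb, fun j hj => ?_⟩
  have h1 : (⟨j, hJAB hj⟩ : ↥(A ⊔ B)) ∈ (Q : Subgroup ↥(A ⊔ B)) := hQ hj
  rw [← hg, Sylow.coe_subgroup_smul, Subgroup.mem_pointwise_smul_iff_inv_smul_mem] at h1
  have h2 : (b * a)⁻¹ * j * (b * a) ∈ A := by
    simpa [T, Subgroup.mem_subgroupOf, MulAut.smul_def] using h1
  have h3 : (b⁻¹ * j * b) = a * ((b * a)⁻¹ * j * (b * a)) * a⁻¹ := by group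
  rw [h3]
  exact mul_mem (mul_mem ha h2) (inv_mem ha)

/-- The `p`-part of an element which has `p`-power order modulo `B` lies in the same coset. -/
theorem exists_inv_mul_mem_of_pow_mem [hp : Fact p.Prime] [Finite G] {A B : Subgroup G}
    (hA : ∀ x : G, ∀ n : ℕ, x ^ p ^ n = 1 → x ∈ A) {y : G} {k : ℕ} (hy : y ^ p ^ k ∈ B) :
    ∃ a ∈ A, a⁻¹ * y ∈ B := by
  obtain ⟨e, q, hq, ho⟩ := Nat.exists_eq_pow_mul_and_not_dvd (orderOf_pos y).ne' p hp.out.ne_one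
  have hcop : Nat.Coprime q (p ^ k) :=
    (((Nat.Prime.coprime_iff_not_dvd hp.out).2 hq).pow_left k).symm
  obtain ⟨i, hi0, hi1⟩ := Nat.chineseRemainder hcop 0 1
  refine ⟨y ^ i, hA _ e ?_, ?_⟩
  · rw [← pow_mul, ← orderOf_dvd_iff_pow_eq_one, ho, mul_comm]
    exact mul_dvd_mul_right ((Nat.modEq_zero_iff_dvd).1 hi0) _
  · obtain ⟨c, hc⟩ := (Nat.modEq_iff_dvd).1 hi1
    have : (y ^ i)⁻¹ * y = (y ^ p ^ k) ^ c := by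
      rw [← zpow_natCast, ← zpow_neg, ← zpow_add_one, ← zpow_natCast, ← zpow_mul]
      congr 1
      push_cast at hc ⊢
      linarith
    rw [this]
    exact zpow_mem hy c

end FiniteGroup

namespace IsLocality

open CategoryTheory

variable {p : ℕ} {P : Data L} {Δ : Set (Set L)} {S : Set L} {h : IsLocality p P Δ S}

/-- The normalizer of an object, as a group: the automorphisms in the groupoid of steps. -/
def Nrm (X : h.Obj) := X ⟶ X

instance (X : h.Obj) : Group (Nrm X) where
  mul f g := f ≫ g
  one := 𝟙 X
  inv f := Groupoid.inv f
  mul_assoc := Category.assoc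
  one_mul := Category.id_comp
  mul_one := Category.comp_id
  inv_mul_cancel := Groupoid.inv_comp

/-- The underlying element of the partial group. -/
def Nrm.val {X : h.Obj} (n : Nrm X) : L := Subtype.val (show X ⟶ X from n)

namespace Nrm

variable {X Y : h.Obj}

theorem step (n : Nrm X) : Step P Δ X.carrier n.val X.carrier :=
  Subtype.property (show X ⟶ X from n)

theorem val_injective : Function.Injective (Nrm.val (X := X)) := Subtype.val_injective

/-- The element of the normalizer given by a step from an object to itself. -/
def mk {f : L} (s : Step P Δ X.carrier f X.carrier) : Nrm X := ⟨f, s⟩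

@[simp] theorem val_mk {f : L} (s : Step P Δ X.carrier f X.carrier) : (mk s).val = f := rfl

@[simp] theorem val_mul (m n : Nrm X) : (m * n).val = P.mul m.val n.val := rfl

@[simp] theorem val_inv (n : Nrm X) : (n⁻¹).val = P.inv n.val := rfl

@[simp] theorem val_one : (1 : Nrm X).val = P.one := rfl

instance : Finite (Nrm X) :=
  have := h.finite
  Finite.of_injective _ val_injective

/-- Conjugation by a morphism. -/
def cj (g : X ⟶ Y) : Nrm X ≃* Nrm Y where
  toFun n := Groupoid.inv g ≫ n ≫ g
  invFun n := g ≫ n ≫ Groupoid.inv g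
  left_inv := fun n : X ⟶ X =>
    show g ≫ (Groupoid.inv g ≫ n ≫ g) ≫ Groupoid.inv g = n by simp
  right_inv := fun n : Y ⟶ Y =>
    show Groupoid.inv g ≫ (g ≫ n ≫ Groupoid.inv g) ≫ g = n by simp
  map_mul' := fun m n : X ⟶ X =>
    show Groupoid.inv g ≫ (m ≫ n) ≫ g = (Groupoid.inv g ≫ m ≫ g) ≫ Groupoid.inv g ≫ n ≫ g by
      simp

@[simp] theorem val_cj (g : X ⟶ Y) (n : Nrm X) : (cj g n).val = P.conj n.val g.1 := conj_val n g

theorem mem_Dconj (g : X ⟶ Y) (n : Nrm X) : n.val ∈ P.Dconj g.1 := (conj_val' g n g rfl).1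

theorem cj_comp_self (g : X ⟶ Y) (b : Nrm Y) (n : Nrm X) :
    cj (g ≫ b) n = b⁻¹ * cj g n * b := by
  have key (b : Y ⟶ Y) (n : X ⟶ X) : Groupoid.inv (g ≫ b) ≫ n ≫ (g ≫ b) =
      (Groupoid.inv b ≫ (Groupoid.inv g ≫ n ≫ g)) ≫ b := by simp
  exact key b n

theorem val_conj (n b : Nrm X) : (b⁻¹ * n * b).val = P.conj n.val b.val := by
  rw [mul_assoc]
  exact conj_val n b

theorem isPSubgroup_image {C : Subgroup (Nrm X)} (hC : IsPGroup p C) (hp : p.Prime) :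
    P.IsPSubgroup p (Nrm.val '' (C : Set (Nrm X))) := by
  have := Fact.mk hp
  have hw : ∀ w : List L, (∀ x ∈ w, x ∈ Nrm.val '' (C : Set (Nrm X))) →
      chainFrom P Δ w X.carrier := by
    intro w hw
    induction w with
    | nil => trivial
    | cons a w ih =>
      obtain ⟨c, -, rfl⟩ := hw a (by simp)
      exact c.step.chainFrom_cons (ih fun x hx => hw x (by simp [hx]))
  refine ⟨⟨⟨?_, h.isPartialGroup.pi_mem ?_ ?_⟩, fun w hw' => h.word_mem_D X.mem (hw w hw')⟩, ?_⟩
  · rintro _ ⟨c, hc, rfl⟩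
    exact ⟨c⁻¹, inv_mem hc, rfl⟩
  · exact ⟨1, one_mem C, rfl⟩
  · rintro _ ⟨c, hc, rfl⟩ _ ⟨d, hd, rfl⟩ -
    exact ⟨c * d, mul_mem hc hd, rfl⟩
  · obtain ⟨n, hn⟩ := IsPGroup.iff_card.1 hC
    exact ⟨n, by rw [val_injective.injOn.ncard_image, ← hn]; rfl⟩

end Nrm

/-- The elements of `S` normalizing an object. -/
def NS (X : h.Obj) : Subgroup (Nrm X) where
  carrier := {n | n.val ∈ S}
  mul_mem' ha hb := h.isSubgroup.mul_mem ha hb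
  one_mem' := h.isSubgroup.one_mem
  inv_mem' ha := h.isSubgroup.inv_mem ha

/-- The elements of a normal set which normalize an object. -/
def NM {M : Set L} (hM : P.IsNormalSet M) (X : h.Obj) : Subgroup (Nrm X) where
  carrier := {n | n.val ∈ M}
  mul_mem' {a b} ha hb := hM.mul_mem ha hb (h.mem_D₂ a.step b.step)
  one_mem' := hM.one_mem
  inv_mem' ha := hM.inv_mem ha

theorem mem_NM {M : Set L} {hM : P.IsNormalSet M} {X : h.Obj} {n : Nrm X} :
    n ∈ NM hM X ↔ n.val ∈ M := Iff.rfl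

instance {M : Set L} (hM : P.IsNormalSet M) (X : h.Obj) : (NM hM X).Normal where
  conj_mem n hn g := by
    have := Nrm.val_conj n g⁻¹
    rw [inv_inv] at this
    rw [mem_NM, this]
    exact hM.conj_mem hn (Nrm.mem_Dconj g⁻¹ n)

/-- The object `S`. -/
def topObj (h : IsLocality p P Δ S) : h.Obj := ⟨S, h.S_mem⟩

/-- An element of `S`, as an element of the normalizer of `S`. -/
def ofS (h : IsLocality p P Δ S) {x : L} (hx : x ∈ S) : Nrm h.topObj :=
  Nrm.mk (h.step_self h.S_mem hx)

@[simp] theorem val_ofS {x : L} (hx : x ∈ S) : (h.ofS hx).val = x := rfl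

theorem isPGroup_NS_topObj (h : IsLocality p P Δ S) : IsPGroup p (NS h.topObj) := by
  obtain ⟨n, hn⟩ := h.pSubgroup.2
  refine IsPGroup.of_card (n := n) ?_
  rw [← hn]
  exact Nat.card_congr ⟨fun n => ⟨n.1.val, n.2⟩, fun x => ⟨h.ofS x.2, x.2⟩, fun _ => rfl,
    fun _ => rfl⟩

theorem isPGroup_NS (X : h.Obj) : IsPGroup p (NS X) :=
  h.isPGroup_NS_topObj.of_injective
    (⟨⟨fun n => ⟨h.ofS n.2, n.2⟩, rfl⟩, fun _ _ => rfl⟩ : NS X →* NS h.topObj)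
    fun _ _ hmn => Subtype.ext (Nrm.val_injective
      (congrArg (fun x : NS h.topObj => x.1.val) hmn))

/-- `N_S(X)` is a Sylow `p`-subgroup of the normalizer of `X`. -/
def IsFullyNormalized (X : h.Obj) : Prop :=
  ∀ C : Subgroup (Nrm X), IsPGroup p C → NS X ≤ C → C ≤ NS X

theorem isFullyNormalized_topObj (hp : p.Prime) : IsFullyNormalized h.topObj := by
  intro C hC hle c hc
  have h1 := h.s_maximal _ (Nrm.isPSubgroup_image hC hp) fun x hx =>
    ⟨h.ofS hx, hle (show x ∈ S from hx), rfl⟩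
  exact h1.subset ⟨c, hc, rfl⟩

theorem IsFullyNormalized.exists_conj {X Y : h.Obj} (hY : IsFullyNormalized Y) (hp : p.Prime)
    (g : X ⟶ Y) {C : Subgroup (Nrm X)} (hC : IsPGroup p C) :
    ∃ g' : X ⟶ Y, ∀ c ∈ C, P.conj c.val g'.1 ∈ S := by
  have := Fact.mk hp
  obtain ⟨b, -, hb⟩ := IsPGroup.exists_conj_mem (B := ⊤) (isPGroup_NS Y)
    (fun C hC h1 _ => hY C hC h1) (hC.map (Nrm.cj g).toMonoidHom) (by simp)
  refine ⟨g ≫ b, fun c hc => ?_⟩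
  rw [← Nrm.val_cj, Nrm.cj_comp_self]
  exact hb _ ⟨c, hc, rfl⟩

end IsLocality

namespace IsLocality

open CategoryTheory

variable {p : ℕ} {P : Data L} {Δ : Set (Set L)} {S : Set L} {h : IsLocality p P Δ S}

theorem step_self_of_subset (h : IsLocality p P Δ S) {Q R : Set L} {f : L} (s : Step P Δ Q f R)
    (hRQ : R ⊆ Q) : Step P Δ Q f Q := by
  have := h.finite
  have e : R = Q := Set.eq_of_subset_of_ncard_le hRQ (h.ncard_eq_of_step s).ge
  rwa [e] at s

/-- An object, as a subgroup of the normalizer of `S`. -/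
def objSubgroup (X : h.Obj) : Subgroup (Nrm h.topObj) where
  carrier := {n | n.val ∈ X.carrier}
  mul_mem' ha hb := (h.isSubgroup_obj X.mem).mul_mem ha hb
  one_mem' := (h.isSubgroup_obj X.mem).one_mem
  inv_mem' ha := (h.isSubgroup_obj X.mem).inv_mem ha

theorem mem_objSubgroup {X : h.Obj} {n : Nrm h.topObj} :
    n ∈ objSubgroup X ↔ n.val ∈ X.carrier := Iff.rfl

theorem objSubgroup_le (X : h.Obj) : objSubgroup X ≤ NS h.topObj :=
  fun _ hx => h.subset_S X.mem hx

theorem step_of_normalizing {X : h.Obj} {x : Nrm h.topObj} (hx : x ∈ NS h.topObj)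
    (hn : ∀ a, a ∈ objSubgroup X ↔ x * a * x⁻¹ ∈ objSubgroup X) :
    Step P Δ X.carrier x.val X.carrier := by
  refine h.step_self_of_subset (h.step_of_mem_S X.mem hx) ?_
  rintro _ ⟨y, hy, rfl⟩
  have hyS := h.subset_S X.mem hy
  have h1 := (hn (x⁻¹ * h.ofS hyS * x)).2 (by
    rwa [show x * (x⁻¹ * h.ofS hyS * x) * x⁻¹ = h.ofS hyS by group])
  rwa [mem_objSubgroup, Nrm.val_conj] at h1

/-- The object `N_S(X)`. -/
def nsObj (X : h.Obj) : h.Obj where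
  carrier := Nrm.val '' (NS X : Set (Nrm X))
  mem := by
    have hsub : Nrm.val '' (NS X : Set (Nrm X)) ⊆ S := by
      rintro _ ⟨n, hn, rfl⟩
      exact hn
    refine h.obj_of_superset X.mem (h.isPartialGroup.isSubgroup_of_subset h.isSubgroup hsub
      ⟨1, one_mem _, rfl⟩ ?_ ?_)
      (fun x hx => ⟨Nrm.mk (h.step_self X.mem hx), h.subset_S X.mem hx, rfl⟩) hsub
    · rintro _ ⟨n, hn, rfl⟩
      exact ⟨n⁻¹, inv_mem hn, rfl⟩
    · rintro _ ⟨n, hn, rfl⟩ _ ⟨m, hm, rfl⟩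
      exact ⟨n * m, mul_mem hn hm, rfl⟩

theorem mem_nsObj {X : h.Obj} {x : L} :
    x ∈ (nsObj X).carrier ↔ x ∈ S ∧ Step P Δ X.carrier x X.carrier := by
  constructor
  · rintro ⟨n, hn, rfl⟩
    exact ⟨hn, n.step⟩
  · rintro ⟨hx, s⟩
    exact ⟨Nrm.mk s, hx, rfl⟩

theorem subset_nsObj (X : h.Obj) : X.carrier ⊆ (nsObj X).carrier := fun _ hx =>
  mem_nsObj.2 ⟨h.subset_S X.mem hx, h.step_self X.mem hx⟩

theorem exists_mem_nsObj (hp : p.Prime) {X : h.Obj} {B : Subgroup (Nrm h.topObj)}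
    (hB : B ≤ NS h.topObj) (hXB : objSubgroup X < B) :
    ∃ x ∈ B, x.val ∈ (nsObj X).carrier ∧ x.val ∉ X.carrier := by
  have := Fact.mk hp
  obtain ⟨x, hx, hxX, hn⟩ :=
    (h.isPGroup_NS_topObj.to_le hB).exists_mem_normalizing hXB
  exact ⟨x, hx, mem_nsObj.2 ⟨hB hx, step_of_normalizing (hB hx) hn⟩, hxX⟩

theorem ncard_lt_nsObj (hp : p.Prime) {X : h.Obj} (hX : X.carrier ≠ S) :
    X.carrier.ncard < (nsObj X).carrier.ncard := by
  have := h.finite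
  have hlt : objSubgroup X < NS h.topObj := by
    refine lt_of_le_of_ne (objSubgroup_le X) fun e => hX ?_
    refine (h.subset_S X.mem).antisymm fun x hx => ?_
    have : h.ofS hx ∈ NS h.topObj := hx
    rwa [← e] at this
  obtain ⟨x, -, h1, h2⟩ := exists_mem_nsObj hp le_rfl hlt
  exact Set.ncard_lt_ncard ⟨subset_nsObj X, fun h3 => h2 (h3 h1)⟩

instance : Finite h.Obj :=
  have := h.finite
  Finite.of_injective Obj.carrier fun _ _ => Obj.ext

/-- Every object is conjugate to a fully normalized one. -/
theorem exists_hom_isFullyNormalized (hp : p.Prime) (X : h.Obj) :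
    ∃ Y, ∃ _ : X ⟶ Y, IsFullyNormalized Y := by
  have := h.finite
  have := Fact.mk hp
  induction hn : S.ncard - X.carrier.ncard using Nat.strong_induction_on generalizing X with
  | _ n ih =>
  obtain ⟨Y, ⟨g⟩, hmax⟩ := Set.exists_max_image {Y : h.Obj | Nonempty (X ⟶ Y)}
    (fun Y => Nat.card (NS Y)) (Set.toFinite _) ⟨X, ⟨𝟙 X⟩⟩
  by_contra hcon
  have hY : ¬ IsFullyNormalized Y := fun hY => hcon ⟨Y, g, hY⟩
  have hYS : Y.carrier ≠ S := by
    intro e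
    apply hY
    rw [show Y = h.topObj from Obj.ext e]
    exact isFullyNormalized_topObj hp
  simp only [IsFullyNormalized, not_forall] at hY
  obtain ⟨C, hC, hle, hC'⟩ := hY
  obtain ⟨x, hxC, hx, hxn⟩ := hC.exists_mem_normalizing (lt_of_le_not_ge hle hC')
  let D : Subgroup (Nrm Y) := C ⊓ Subgroup.normalizer (NS Y : Set (Nrm Y))
  have hstep (d : Nrm Y) (hd : d ∈ D) :
      Step P Δ (nsObj Y).carrier d.val (nsObj Y).carrier := by
    have hd' := Subgroup.mem_normalizer_iff''.1 hd.2
    have hc : P.conjSet (nsObj Y).carrier d.val ⊆ (nsObj Y).carrier := by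
      rintro _ ⟨_, ⟨y, hy, rfl⟩, rfl⟩
      exact ⟨d⁻¹ * y * d, (hd' y).1 hy, Nrm.val_conj y d⟩
    have he : P.conjSet (nsObj Y).carrier d.val = (nsObj Y).carrier := by
      refine hc.antisymm ?_
      rintro _ ⟨y, hy, rfl⟩
      refine ⟨_, ⟨d * y * d⁻¹, (Subgroup.mem_normalizer_iff.1 hd.2 y).1 hy, rfl⟩, ?_⟩
      change P.conj _ _ = _
      rw [← Nrm.val_conj]
      congr 1
      group
    refine ⟨(nsObj Y).mem, (nsObj Y).mem, ?_, he⟩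
    rintro _ ⟨y, -, rfl⟩
    exact Nrm.mem_Dconj d y
  let φ : D →* Nrm (nsObj Y) := ⟨⟨fun d => Nrm.mk (hstep d.1 d.2), rfl⟩, fun _ _ => rfl⟩
  have hDp : IsPGroup p D := hC.to_le inf_le_left
  have hlt : S.ncard - (nsObj Y).carrier.ncard < n := by
    have h1 := ncard_lt_nsObj hp hYS
    have h2 := h.ncard_eq_of_step g.2
    have h3 := Set.ncard_le_ncard (h.subset_S (nsObj Y).mem)
    omega
  obtain ⟨Z, g₁, hZ⟩ := ih _ hlt (nsObj Y) rfl
  obtain ⟨g₂, hg₂⟩ := hZ.exists_conj hp g₁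
    (hDp.of_surjective φ.rangeRestrict φ.rangeRestrict_surjective)
  have t := h.step_mono g₂.2 Y.mem (subset_nsObj Y)
  have hle' : D.map (Nrm.cj (h.hom t)).toMonoidHom ≤ NS ⟨_, t.right⟩ := by
    rintro _ ⟨d, hd, rfl⟩
    change (Nrm.cj (h.hom t) d).val ∈ S
    rw [Nrm.val_cj]
    exact hg₂ (φ ⟨d, hd⟩) ⟨_, rfl⟩
  have hcard : Nat.card D ≤ Nat.card (NS Y) :=
    calc Nat.card D = Nat.card (D.map (Nrm.cj (h.hom t)).toMonoidHom) :=
          (Subgroup.card_map_of_injective (Nrm.cj (h.hom t)).injective).symm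
      _ ≤ _ := Subgroup.card_le_of_le hle'
      _ ≤ _ := hmax ⟨_, t.right⟩ ⟨g ≫ h.hom t⟩
  have heq := Subgroup.eq_of_le_of_card_ge (le_inf hle Subgroup.le_normalizer) hcard
  apply hx
  rw [heq]
  exact ⟨hxC, Subgroup.mem_normalizer_iff.2 hxn⟩

/-- Every `p`-subgroup of the normalizer of an object can be conjugated into `S`. -/
theorem exists_hom_conj_mem (hp : p.Prime) {X : h.Obj} {C : Subgroup (Nrm X)}
    (hC : IsPGroup p C) :
    ∃ Y, ∃ g : X ⟶ Y, IsFullyNormalized Y ∧ ∀ c ∈ C, P.conj c.val g.1 ∈ S := by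
  obtain ⟨Y, g, hY⟩ := exists_hom_isFullyNormalized hp X
  obtain ⟨g', hg'⟩ := hY.exists_conj hp g hC
  exact ⟨Y, g', hY, hg'⟩

/-- If the object `X` contains `S ∩ M`, then `N_S(X)` is a Sylow subgroup of `N_S(X) N_M(X)`. -/
theorem le_NS_of_le_sup (hp : p.Prime) {M : Set L} {hM : P.IsNormalSet M} {X : h.Obj}
    (hX : S ∩ M ⊆ X.carrier) {C : Subgroup (Nrm X)} (hC : IsPGroup p C) (hle : NS X ≤ C)
    (hCM : C ≤ NS X ⊔ NM hM X) : C ≤ NS X := by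
  have := h.finite
  obtain ⟨Y, g, -, hg⟩ := exists_hom_conj_mem hp hC
  have key : ∀ c ∈ C, c.val ∈ M → c.val ∈ S := by
    let B : Set L := Nrm.val '' {c : Nrm X | c ∈ C ∧ c.val ∈ M}
    have h1 : S ∩ M ⊆ B := fun x hx =>
      ⟨Nrm.mk (h.step_self X.mem (hX hx)), ⟨hle (show x ∈ S from hx.1), hx.2⟩, rfl⟩
    have h2 : B.ncard ≤ (S ∩ M).ncard := by
      refine Set.ncard_le_ncard_of_injOn (fun x => P.conj x g.1) ?_ ?_
      · rintro _ ⟨c, ⟨hc, hcM⟩, rfl⟩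
        exact ⟨hg c hc, hM.conj_mem hcM (Nrm.mem_Dconj g c)⟩
      · rintro _ ⟨c, -, rfl⟩ _ ⟨d, -, rfl⟩ hcd
        change P.conj _ _ = P.conj _ _ at hcd
        rw [← Nrm.val_cj, ← Nrm.val_cj] at hcd
        rw [(Nrm.cj g).injective (Nrm.val_injective hcd)]
    have h3 := Set.eq_of_subset_of_ncard_le h1 h2
    intro c hc hcM
    have : c.val ∈ B := ⟨c, ⟨hc, hcM⟩, rfl⟩
    rw [← h3] at this
    exact this.1
  intro c hc
  obtain ⟨a, ha, b, hb, rfl⟩ := Subgroup.mem_sup_of_normal_right.1 (hCM hc)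
  refine mul_mem ha (key b ?_ hb)
  exact (Subgroup.mul_mem_cancel_left _ (hle ha)).1 hc

end IsLocality

namespace IsLocality

open CategoryTheory

variable {p : ℕ} {P : Data L} {Δ : Set (Set L)} {S : Set L} {h : IsLocality p P Δ S}

/-- `k = fm` for some `m ∈ M` such that `S_f ⊆ S_k`. -/
def Link (P : Data L) (Δ : Set (Set L)) (S M : Set L) (f k : L) : Prop :=
  ∃ m ∈ M, ∃ R R', Step P Δ (P.SOf S f) f R ∧ Step P Δ R m R' ∧ P.mul f m = k

namespace Link

variable {M : Set L} {f k l : L}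

theorem refl (h : IsLocality p P Δ S) (hM : P.IsNormalSet M) (f : L) : Link P Δ S M f f :=
  ⟨P.one, hM.one_mem, _, _, h.step_SOf f, h.step_one (h.step_SOf f).right,
    (h.isPartialGroup.mul_one' f).2⟩

theorem SOf_subset (h : IsLocality p P Δ S) (hfk : Link P Δ S M f k) :
    P.SOf S f ⊆ P.SOf S k := by
  obtain ⟨m, -, R, R', s, t, rfl⟩ := hfk
  exact h.mem_SOf_of_step (h.step_mul s t)

theorem trans (h : IsLocality p P Δ S) (hM : P.IsNormalSet M) (hfk : Link P Δ S M f k)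
    (hkl : Link P Δ S M k l) : Link P Δ S M f l := by
  have hle := hfk.SOf_subset h
  obtain ⟨m, hm, R, R', s, t, rfl⟩ := hfk
  obtain ⟨m', hm', T, T', s', t', rfl⟩ := hkl
  have t'' := h.step_mono t' t.right ((h.step_mul s t).mono s' hle)
  exact ⟨P.mul m m', hM.mul_mem hm hm' (h.mem_D₂ t t''), R, _, s, h.step_mul t t'',
    (h.isPartialGroup.mul_assoc' (h.mem_D₃ s t t'')).symm⟩

theorem mul_mem (h : IsLocality p P Δ S) (hfk : Link P Δ S M f k) :
    ∃ m ∈ M, [f, m] ∈ P.D ∧ P.mul f m = k := by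
  obtain ⟨m, hm, R, R', s, t, rfl⟩ := hfk
  exact ⟨m, hm, h.mem_D₂ s t, rfl⟩

end Link

theorem exists_mem_normal_nsObj (hp : p.Prime) {M : Set L} (hM : P.IsNormalSet M) {X : h.Obj}
    (hX : ¬ S ∩ M ⊆ X.carrier) :
    ∃ x ∈ S ∩ M, x ∉ X.carrier ∧ Step P Δ X.carrier x X.carrier := by
  have := Fact.mk hp
  obtain ⟨x, hxM, hx, hn⟩ := IsPGroup.exists_mem_normal_normalizing h.isPGroup_NS_topObj
    (A := (objSubgroup X).subgroupOf (NS h.topObj))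
    (B := (NM hM h.topObj).subgroupOf (NS h.topObj))
    (fun hle => hX fun x hx => @hle ⟨h.ofS hx.1, hx.1⟩ hx.2)
  refine ⟨x.1.val, ⟨x.2, hxM⟩, hx, step_of_normalizing x.2 fun a => ⟨fun ha => ?_, fun ha => ?_⟩⟩
  · exact (hn ⟨a, objSubgroup_le X ha⟩).1 ha
  · have : a = x.1⁻¹ * (x.1 * a * x.1⁻¹) * x.1 := by group
    have ha' : a ∈ NS h.topObj := by
      rw [this]
      exact mul_mem (mul_mem (inv_mem x.2) (objSubgroup_le X ha)) x.2
    exact (hn ⟨a, ha'⟩).2 ha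

/-- Every element can be modified by an element of a normal set `M` so as to be defined on
`S ∩ M`, without losing any of its domain. -/
theorem exists_link (hp : p.Prime) (h : IsLocality p P Δ S) {M : Set L} (hM : P.IsNormalSet M)
    (f : L) : ∃ k, Link P Δ S M f k ∧ S ∩ M ⊆ P.SOf S k := by
  have := h.finite
  have := Fact.mk hp
  induction hn : S.ncard - (P.SOf S f).ncard using Nat.strong_induction_on generalizing f with
  | _ n ih =>
  have hSle (g : L) : (P.SOf S g).ncard ≤ S.ncard := Set.ncard_le_ncard fun x hx => hx.1
  by_cases hTf : S ∩ M ⊆ P.SOf S f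
  · exact ⟨f, .refl h hM f, hTf⟩
  have s := h.step_SOf f
  let X : h.Obj := ⟨_, s.left⟩
  let Q : h.Obj := ⟨_, s.right⟩
  let F : X ⟶ Q := h.hom s
  obtain ⟨x, hxT, hxf, hx⟩ := exists_mem_normal_nsObj hp hM (X := X) hTf
  obtain ⟨Y, g, hY, hg⟩ := exists_hom_conj_mem hp (isPGroup_NS Q)
  -- extend `f` to the element `x` of `S ∩ M`
  obtain ⟨b, hb, hb'⟩ := IsPGroup.exists_conj_mem (B := NM hM Y) (isPGroup_NS Y)
    (fun C hC h1 _ => hY C hC h1)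
    (((isPGroup_NS X).to_le inf_le_left : IsPGroup p ↥(NS X ⊓ NM hM X)).map
      (Nrm.cj (F ≫ g)).toMonoidHom) (by
        refine le_sup_of_le_right ?_
        rintro _ ⟨v, hv, rfl⟩
        change (Nrm.cj (F ≫ g) v).val ∈ M
        rw [Nrm.val_cj]
        exact hM.conj_mem hv.2 (Nrm.mem_Dconj _ _))
  let bY : Y ⟶ Y := b
  let F₁ : X ⟶ Y := (F ≫ g) ≫ bY
  have hf₁ : P.SOf S f ⊆ P.SOf S F₁.1 := h.mem_SOf_of_step F₁.2
  have hx₁ : x ∈ P.SOf S F₁.1 := by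
    refine ⟨hxT.1, Nrm.mem_Dconj F₁ (Nrm.mk hx), ?_⟩
    have := hb' _ ⟨Nrm.mk hx, ⟨hxT.1, hxT.2⟩, rfl⟩
    change (b⁻¹ * Nrm.cj (F ≫ g) (Nrm.mk hx) * b).val ∈ S at this
    rwa [← Nrm.cj_comp_self, Nrm.val_cj] at this
  have hlt₁ : (P.SOf S f).ncard < (P.SOf S F₁.1).ncard :=
    Set.ncard_lt_ncard ⟨hf₁, fun h3 => hxf (h3 hx₁)⟩
  obtain ⟨f₂, ⟨m₁, hm₁, R₁, R₁', s₁, t₁, rfl⟩, hT₂⟩ :=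
    ih _ (by have := hSle F₁.1; omega) F₁.1 rfl
  -- the inverse of `g` is defined on more than `S_f`
  have hlt₂ : (P.SOf S f).ncard < (P.SOf S (P.inv g.1)).ncard := by
    have hQX : Q.carrier.ncard = X.carrier.ncard := h.ncard_eq_of_step s
    have hQS : Q.carrier ≠ S := by
      intro e
      apply hTf
      have : X.carrier = S := Set.eq_of_subset_of_ncard_le (h.subset_S X.mem)
        (by rw [← hQX, e])
      exact fun y hy => this.superset hy.1
    calc (P.SOf S f).ncard = Q.carrier.ncard := hQX.symm
      _ < (nsObj Q).carrier.ncard := ncard_lt_nsObj hp hQS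
      _ ≤ _ := by
        have hsub : (nsObj Q).carrier ⊆ P.SOf S g.1 := by
          rintro _ ⟨c, hc, rfl⟩
          exact ⟨hc, Nrm.mem_Dconj g c, hg c hc⟩
        exact Set.ncard_le_ncard_of_injOn (fun y => P.conj y g.1)
          (fun y hy => h.conj_mem_SOf_inv (hsub hy))
          ((h.conj_injOn (h.step_SOf g.1)).mono hsub)
  obtain ⟨h₀, ⟨m₀, hm₀, R₀, R₀', s₀, t₀, rfl⟩, hT₀⟩ :=
    ih _ (by have := hSle (P.inv g.1); omega) (P.inv g.1) rfl
  -- assemble `f₂ h₀`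
  have u₁ : Step P Δ Y.carrier m₁ (P.conjSet Y.carrier m₁) :=
    h.step_mono t₁ Y.mem (F₁.2.mono s₁ hf₁)
  have hYg : Y.carrier ⊆ P.SOf S (P.inv g.1) := h.mem_SOf_of_step (Groupoid.inv g).2
  have u₀ : Step P Δ Q.carrier m₀ (P.conjSet Q.carrier m₀) :=
    h.step_mono t₀ Q.mem ((Groupoid.inv g).2.mono s₀ hYg)
  let A₁ : Y ⟶ ⟨_, u₁.right⟩ := h.hom u₁
  let A₀ : Q ⟶ ⟨_, u₀.right⟩ := h.hom u₀
  have hm₄ : (bY ≫ A₁).1 ∈ M := hM.mul_mem hb hm₁ (h.mem_D₂ b.step u₁)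
  have hY₀ : Y.carrier ⊆ P.SOf S (P.mul (P.inv g.1) m₀) :=
    h.mem_SOf_of_step (Groupoid.inv g ≫ A₀).2
  have hY₁ := h.subset_of_step_normal hM hm₄ (h.step_SOf (P.mul (P.inv g.1) m₀)).left hT₀
    (bY ≫ A₁).2 hY₀
  have v := h.step_of_subset_SOf u₁.right hY₁
  let H : (⟨_, u₁.right⟩ : h.Obj) ⟶ ⟨_, v.right⟩ := h.hom v
  have hm' : (g ≫ (bY ≫ A₁) ≫ H).1 ∈ M := by
    have e : g ≫ (bY ≫ A₁) ≫ H =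
        A₀ ≫ (Groupoid.inv (Groupoid.inv g ≫ A₀) ≫ (bY ≫ A₁) ≫ H) := by simp
    have e' := conj_val' (Groupoid.inv g ≫ A₀) (bY ≫ A₁) H rfl
    rw [e, comp_val]
    refine hM.mul_mem hm₀ ?_ (h.mem_D₂ A₀.2
      (Groupoid.inv (Groupoid.inv g ≫ A₀) ≫ (bY ≫ A₁) ≫ H).2)
    rw [e'.2]
    exact hM.conj_mem hm₄ e'.1
  refine ⟨P.mul (P.mul F₁.1 m₁) (P.mul (P.inv g.1) m₀),
    ⟨_, hm', _, _, s, (g ≫ (bY ≫ A₁) ≫ H).2, ?_⟩, fun y hy => ?_⟩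
  · exact congrArg Subtype.val
      (show F ≫ g ≫ (bY ≫ A₁) ≫ H = (F₁ ≫ A₁) ≫ H by simp [F₁])
  · have hy' := hT₂ hy
    exact (h.mem_SOf_mul (h.mem_D₂ (F₁ ≫ A₁).2 H.2) hy'
      (hT₀ ⟨hy'.2.2, hM.conj_mem hy.2 hy'.2.1⟩)).1

end IsLocality

theorem Step.congr_left {P : Data L} {Δ : Set (Set L)} {Q Q' R : Set L} {f : L}
    (s : Step P Δ Q f R) (e : Q = Q') : Step P Δ Q' f R :=
  e ▸ s

namespace IsLocality

open CategoryTheory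

variable {p : ℕ} {P : Data L} {Δ : Set (Set L)} {S : Set L} {h : IsLocality p P Δ S}

theorem mul_inv_conj_mem (h : IsLocality p P Δ S) {N : Set L} (hN : P.IsNormalSet N) {k x : L}
    (hk : k ∈ N) (hx : x ∈ S) (s : Step P Δ (P.SOf S k) x (P.SOf S k)) :
    [P.inv x, P.conj x k] ∈ P.D ∧ P.mul (P.inv x) (P.conj x k) ∈ N := by
  let K := h.hom (h.step_SOf k)
  let X := h.hom s
  let Z := h.hom (h.step_of_mem_S (h.step_SOf k).right hx)
  have e := conj_val' Z (Groupoid.inv K) X rfl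
  have e' := conj_val X K
  have hD := h.mem_D₂ (Groupoid.inv Z).2 (Groupoid.inv K ≫ X ≫ K).2
  rw [e'] at hD
  have hD' := h.mem_D₂ (Groupoid.inv Z ≫ Groupoid.inv K ≫ X).2 K.2
  rw [e.2] at hD'
  refine ⟨hD, ?_⟩
  have key : P.mul (P.conj (P.inv k) x) k = P.mul (P.inv x) (P.conj x k) := by
    refine (congrArg (P.mul · k) e.2.symm).trans (Eq.trans ?_ (congrArg (P.mul (P.inv x)) e'))
    change ((Groupoid.inv Z ≫ Groupoid.inv K ≫ X) ≫ K).1 =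
      (Groupoid.inv Z ≫ Groupoid.inv K ≫ X ≫ K).1
    simp
  rw [← key]
  exact hN.mul_mem (hN.conj_mem (hN.inv_mem hk) e.1) hk hD'

/-- Every element `f` has an `M`-modification `k` which cannot be extended to an element `x`
normalizing `S_k` whose commutator with `k` lies in `SM`. -/
theorem exists_link_maximal (hp : p.Prime) (h : IsLocality p P Δ S) {M : Set L}
    (hM : P.IsNormalSet M) (f : L) :
    ∃ k, Link P Δ S M f k ∧ ∀ x ∈ S, Step P Δ (P.SOf S k) x (P.SOf S k) →
      (∃ a ∈ S, P.mul (P.inv a) (P.mul (P.inv x) (P.conj x k)) ∈ M) → x ∈ P.SOf S k := by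
  have := h.finite
  have := Fact.mk hp
  obtain ⟨k, ⟨hfk, hT⟩, hmax⟩ := Set.exists_max_image
    {k | Link P Δ S M f k ∧ S ∩ M ⊆ P.SOf S k} (fun k => (P.SOf S k).ncard)
    (Set.toFinite _) (exists_link hp h hM f)
  refine ⟨k, hfk, fun x hx s => ?_⟩
  rintro ⟨a, ha, haM⟩
  have sk := h.step_SOf k
  let X : h.Obj := ⟨_, sk.left⟩
  let Q : h.Obj := ⟨_, sk.right⟩
  let K : X ⟶ Q := h.hom sk
  let ξ : Nrm X := Nrm.mk s
  have hTQ : S ∩ M ⊆ Q.carrier := by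
    have hsub : P.conjSet (S ∩ M) k ⊆ S ∩ M := by
      rintro _ ⟨y, hy, rfl⟩
      exact ⟨(hT hy).2.2, hM.conj_mem hy.2 (hT hy).2.1⟩
    have heq := Set.eq_of_subset_of_ncard_le hsub
      ((h.conj_injOn sk).mono hT).ncard_image.ge
    rw [← heq]
    exact Set.image_mono hT
  let η : Q ⟶ Q := Nrm.cj K ξ
  have hη : η.1 = P.conj x k := Nrm.val_cj K ξ
  let Z := h.hom (h.step_of_mem_S Q.mem hx)
  let A := h.hom (h.step_of_mem_S (h.step_of_mem_S Q.mem hx).right ha)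
  let y := Groupoid.inv A ≫ Groupoid.inv Z ≫ η
  have hy : y.1 ∈ M := by
    rw [← hη] at haM
    exact haM
  have hQ' := h.subset_of_step_normal hM (hM.inv_mem hy) Q.mem hTQ (Groupoid.inv y).2 subset_rfl
  have hσ := h.step_self_of_subset (Z ≫ A).2 hQ'
  have hQ'' := Set.eq_of_subset_of_ncard_le hQ' (h.ncard_eq_of_step (Z ≫ A).2).ge
  have hμ : Step P Δ Q.carrier y.1 Q.carrier :=
    y.2.congr_left hQ''
  have hημ : (η : Nrm Q) = Nrm.mk hσ * Nrm.mk hμ := by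
    apply Nrm.val_injective
    change η.1 = ((Z ≫ A) ≫ y).1
    simp [y]
  have hηsup : (η : Nrm Q) ∈ NS Q ⊔ NM hM Q := by
    rw [hημ]
    exact Subgroup.mul_mem_sup (h.isSubgroup.mul_mem hx ha) hy
  obtain ⟨b, hb, hb'⟩ := IsPGroup.exists_conj_mem (B := NM hM Q) (isPGroup_NS Q)
    (fun C hC h1 h2 => le_NS_of_le_sup hp hTQ hC h1 h2)
    (((isPGroup_NS X).to_le inf_le_left :
      IsPGroup p ↥(NS X ⊓ (NS Q ⊔ NM hM Q).comap (Nrm.cj K).toMonoidHom)).map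
      (Nrm.cj K).toMonoidHom) (by
        rintro _ ⟨v, hv, rfl⟩
        exact hv.2)
  let bQ : Q ⟶ Q := b
  have hlink : Link P Δ S M k (K ≫ bQ).1 := ⟨bQ.1, hb, _, _, sk, bQ.2, rfl⟩
  have hsub := hlink.SOf_subset h
  have heq := Set.eq_of_subset_of_ncard_le hsub
    (hmax _ ⟨hfk.trans h hM hlink, hT.trans hsub⟩)
  rw [heq]
  refine ⟨hx, Nrm.mem_Dconj (K ≫ bQ) ξ, ?_⟩
  have := hb' _ ⟨ξ, ⟨hx, hηsup⟩, rfl⟩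
  change (b⁻¹ * Nrm.cj K ξ * b).val ∈ S at this
  rwa [← Nrm.cj_comp_self, Nrm.val_cj] at this

end IsLocality

theorem IsHom.conj_congr {P : Data L} {P' : Data L'} {β : L → L'} (hβ : IsHom P P' β)
    (hP : IsPartialGroup P) (hP' : IsPartialGroup P') {x x' g g' : L} (hx : x ∈ P.Dconj g)
    (hx' : x' ∈ P.Dconj g') (hxx' : β x = β x') (hgg' : β g = β g') :
    β (P.conj x g) = β (P.conj x' g') := by
  have h1 := hβ.2 _ hx
  have h2 := hβ.2 _ hx'
  simp only [List.map_cons, List.map_nil, hβ.map_inv hP hP', hxx', hgg'] at h1 h2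
  exact h1.symm.trans h2

namespace IsLocality

open CategoryTheory
open scoped commutatorElement

variable {p : ℕ} {P : Data L} {Δ : Set (Set L)} {S : Set L} {h : IsLocality p P Δ S}
  {P' : Data L'} {β : L → L'} {N : Set L}

theorem mem_NS_of_pow_eq_one (hp : p.Prime) {x : Nrm h.topObj} {n : ℕ} (hx : x ^ p ^ n = 1) :
    x ∈ NS h.topObj := by
  have hC : IsPGroup p (Subgroup.zpowers x) := by
    have := Fact.mk hp
    obtain ⟨k, -, hk⟩ := (Nat.dvd_prime_pow hp).1 (orderOf_dvd_of_pow_eq_one hx)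
    exact IsPGroup.of_card (n := k) (by rw [Nat.card_zpowers, hk])
  obtain ⟨g, hg⟩ := (isFullyNormalized_topObj hp).exists_conj hp (𝟙 h.topObj) hC
  have hxg := hg x (Subgroup.mem_zpowers x)
  have e := h.isPartialGroup.conj_inv (Nrm.mem_Dconj g x)
  change x.val ∈ S
  rw [← e.2]
  exact (h.step_inv g.2).conj_mem hxg

theorem mem_Dconj_of_step (h : IsLocality p P Δ S) {Q R : Set L} {f x : L} (s : Step P Δ Q f R)
    (hx : Step P Δ Q x Q) : x ∈ P.Dconj f :=
  h.mem_D₃ (h.step_inv s) hx s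

theorem exists_inv_mul_mem_of_SOf_eq (hp : p.Prime) (h : IsLocality p P Δ S)
    (hN : P.IsNormalSet N) (hK : P.IsNormalSet (pgKer P P' β)) (hβ : IsHom P P' β)
    {s y : L} (hs : s ∈ S) (hy : y ∈ N) (hys : β y = β s) (hyS : P.SOf S y = S) :
    ∃ a ∈ S, P.mul (P.inv a) y ∈ pgKer P P' β ∩ N := by
  have := Fact.mk hp
  have st : Step P Δ S y S :=
    h.step_self_of_subset ((h.step_SOf y).congr_left hyS) (h.subset_S (h.step_SOf y).right)
  let η : Nrm h.topObj := Nrm.mk st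
  let σ : Nrm h.topObj := h.ofS hs
  obtain ⟨k, hk⟩ := h.isPGroup_NS_topObj ⟨σ, hs⟩
  have hk' : σ ^ p ^ k = 1 := congrArg Subtype.val hk
  have hpow (n : ℕ) : β (η ^ n).val = β (σ ^ n).val := by
    induction n with
    | zero => rfl
    | succ n ih =>
      rw [pow_succ, pow_succ]
      exact hβ.mul_congr (h.mem_D₂ (η ^ n).step η.step) (h.mem_D₂ (σ ^ n).step σ.step) ih hys
  obtain ⟨a, ha, ha'⟩ := exists_inv_mul_mem_of_pow_mem (A := NS h.topObj)
    (B := NM (hK.inter hN) h.topObj) (y := η) (k := k)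
    (fun x n hx => mem_NS_of_pow_eq_one hp hx) (by
      refine ⟨?_, pow_mem (show η ∈ NM hN h.topObj from hy) _⟩
      change β _ = _
      rw [hpow, hk']
      exact hK.one_mem)
  exact ⟨a.val, ha, ha'⟩

theorem Link.inv_mul_mem (h : IsLocality p P Δ S) {M : Set L} (hM : P.IsNormalSet M) {f k a : L}
    (hfk : Link P Δ S M f k) (ha : a ∈ S) (hak : P.mul (P.inv a) k ∈ M) :
    P.mul (P.inv a) f ∈ M := by
  obtain ⟨m, hm, R, R', s, t, rfl⟩ := hfk
  let A := h.hom (h.step_of_mem_S s.left ha)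
  let F := h.hom s
  let T := h.hom t
  have hD := h.mem_D₂ (Groupoid.inv A ≫ F ≫ T).2 (Groupoid.inv T).2
  have e : (Groupoid.inv A ≫ F).1 = ((Groupoid.inv A ≫ F ≫ T) ≫ Groupoid.inv T).1 := by simp
  change (Groupoid.inv A ≫ F).1 ∈ M
  rw [e]
  exact hM.mul_mem hak (hM.inv_mem hm) hD

/-- The fibre over an element of `βS` of the restriction of `β` to a normal set `N` is contained
in `S (ker β ∩ N)`. -/
theorem exists_inv_mul_mem (hp : p.Prime) (h : IsLocality p P Δ S) (hP' : IsPartialGroup P')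
    (hN : P.IsNormalSet N) (hK : P.IsNormalSet (pgKer P P' β)) (hβ : IsHom P P' β)
    {s y : L} (hs : s ∈ S) (hy : y ∈ N) (hys : β y = β s) :
    ∃ a ∈ S, P.mul (P.inv a) y ∈ pgKer P P' β ∩ N := by
  have hP := h.isPartialGroup
  have := h.finite
  have := Fact.mk hp
  have hM := hK.inter hN
  have hnil : Group.IsNilpotent (NS h.topObj) := h.isPGroup_NS_topObj.isNilpotent
  obtain ⟨c, hc⟩ := Subgroup.nilpotent_iff_lowerCentralSeries.1 hnil
  suffices key : ∀ j i, Subgroup.lowerCentralSeries (⊤ : Subgroup (NS h.topObj)) (i + j) = ⊥ →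
      ∀ s ∈ Subgroup.lowerCentralSeries (⊤ : Subgroup (NS h.topObj)) i, ∀ y ∈ N, β y = β s.1.val →
        ∃ a ∈ S, P.mul (P.inv a) y ∈ pgKer P P' β ∩ N by
    exact key c 0 (by rwa [zero_add]) ⟨h.ofS hs, hs⟩ (by simp) y hy hys
  intro j
  induction j with
  | zero =>
    intro i hi s hs y hy hys
    rw [add_zero] at hi
    rw [hi, Subgroup.mem_bot] at hs
    subst hs
    refine ⟨P.one, h.isSubgroup.one_mem, ?_⟩
    rw [hP.inv_one, hP.one_mul']
    exact ⟨hys.trans hK.one_mem, hy⟩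
  | succ j ih =>
    intro i hi s hs y hy hys
    obtain ⟨k, hyk, hmax⟩ := exists_link_maximal hp h hM y
    obtain ⟨m, hm, hD, rfl⟩ := hyk.mul_mem h
    have hkN := hN.mul_mem hy hm.2 hD
    have hks : β (P.mul y m) = β s.1.val := by
      rw [← hys]
      exact (hβ.mul_congr hD (hP.mul_one' y).1 rfl (hm.1.trans hK.one_mem.symm)).trans
        (congrArg β (hP.mul_one' y).2)
    generalize P.mul y m = k at *
    by_cases hkS : P.SOf S k = S
    · obtain ⟨a, ha, ha'⟩ := exists_inv_mul_mem_of_SOf_eq hp h hN hK hβ s.2 hkN hks hkS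
      exact ⟨a, ha, hyk.inv_mul_mem h hM ha ha'⟩
    exfalso
    let X : h.Obj := ⟨_, (h.step_SOf k).left⟩
    have hlt : objSubgroup X < NS h.topObj := by
      refine lt_of_le_of_ne (objSubgroup_le X) fun e => hkS ?_
      refine (h.subset_S X.mem).antisymm fun x hx => ?_
      have : h.ofS hx ∈ NS h.topObj := hx
      rwa [← e] at this
    obtain ⟨x, hxS, hx, hxk⟩ := exists_mem_nsObj hp le_rfl hlt
    have st := (mem_nsObj.1 hx).2
    refine hxk (hmax x.val hxS st ?_)
    have hc := mul_inv_conj_mem h hN hkN hxS st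
    let x' : NS h.topObj := ⟨x, hxS⟩
    refine ih (i + 1) (by rwa [add_right_comm]) ⁅x'⁻¹, s⁻¹⁆ ?_ _ hc.2 ?_
    · rw [← commutatorElement_inv]
      exact inv_mem (Subgroup.commutator_mem_commutator (inv_mem hs) (Subgroup.mem_top _))
    · have e : (⁅x'⁻¹, s⁻¹⁆ : NS h.topObj).1.val = P.mul (P.inv x.val) (P.conj x.val s.1.val) := by
        rw [← Nrm.val_conj, ← Nrm.val_inv, ← Nrm.val_mul]
        congr 1
        simp [commutatorElement_def, x', mul_assoc]
      rw [e]
      exact hβ.mul_congr hc.1 (h.isSubgroup.pair_mem (h.isSubgroup.inv_mem hxS)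
        (h.isSubgroup.conj_mem hxS s.2)) rfl (hβ.conj_congr hP hP'
          (h.mem_Dconj_of_step (h.step_SOf k) st) (h.isSubgroup.mem_Dconj hxS s.2) rfl hks)

end IsLocality

namespace IsLocality

open CategoryTheory

variable {p : ℕ} {P : Data L} {Δ : Set (Set L)} {S : Set L} {h : IsLocality p P Δ S}
  {P' : Data L'} {β : L → L'} {N : Set L} {m x y : L}

theorem exists_step_to (h : IsLocality p P Δ S) {Q : Set L} (hQ : Q ∈ Δ) (hx : x ∈ S) :
    ∃ R, Step P Δ R x Q := by
  have := h.step_inv (h.step_of_mem_S hQ (h.isSubgroup.inv_mem hx))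
  rw [h.isPartialGroup.inv_inv] at this
  exact ⟨_, this⟩

theorem mem_D_left (h : IsLocality p P Δ S) (hx : x ∈ S) (hy : y ∈ S) (m : L) :
    [x, y, m] ∈ P.D := by
  obtain ⟨Q, s⟩ := h.exists_step_to (h.step_SOf m).left hy
  obtain ⟨R, t⟩ := h.exists_step_to s.left hx
  exact h.mem_D₃ t s (h.step_SOf m)

theorem mem_D_mid (h : IsLocality p P Δ S) (hx : x ∈ S) (hy : y ∈ S) (m : L) :
    [x, m, y] ∈ P.D := by
  obtain ⟨Q, s⟩ := h.exists_step_to (h.step_SOf m).left hx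
  exact h.mem_D₃ s (h.step_SOf m) (h.step_of_mem_S (h.step_SOf m).right hy)

theorem mem_D_right (h : IsLocality p P Δ S) (hx : x ∈ S) (hy : y ∈ S) (m : L) :
    [m, x, y] ∈ P.D := by
  have s := h.step_of_mem_S (h.step_SOf m).right hx
  exact h.mem_D₃ (h.step_SOf m) s (h.step_of_mem_S s.right hy)

/-- The elements of `S` whose images under `β` are conjugated by `βm` into `βS`. -/
def fibreDom (h : IsLocality p P Δ S) (hβ : IsHom P P' β) (m : L) :
    Subgroup (Nrm h.topObj) where
  carrier := {x | x.val ∈ S ∧ ∃ t ∈ S, β (P.mul x.val m) = β (P.mul m t)}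
  mul_mem' := by
    have hP := h.isPartialGroup
    rintro x y ⟨hx, t, ht, hxt⟩ ⟨hy, u, hu, hyu⟩
    refine ⟨h.isSubgroup.mul_mem hx hy, P.mul t u, h.isSubgroup.mul_mem ht hu, ?_⟩
    have h1 := h.mem_D_left hx hy m
    have h2 := h.mem_D_mid hx hu m
    have h3 := h.mem_D_right ht hu m
    rw [← hP.mul_assoc' h3, Nrm.val_mul, hP.mul_assoc' h1]
    refine (hβ.mul_congr (hP.pi_cons h1).1 (hP.pi_cons h2).1 rfl hyu).trans ?_
    change β (P.mul _ (P.mul m u)) = _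
    rw [← hP.mul_assoc' h2]
    exact hβ.mul_congr (hP.pi_pair_cons h2).1 (hP.pi_pair_cons h3).1 hxt rfl
  one_mem' := by
    refine ⟨h.isSubgroup.one_mem, P.one, h.isSubgroup.one_mem, ?_⟩
    rw [(h.isPartialGroup.mul_one' m).2, Nrm.val_one, h.isPartialGroup.one_mul']
  inv_mem' := by
    have hP := h.isPartialGroup
    rintro x ⟨hx, t, ht, hxt⟩
    have hx' := h.isSubgroup.inv_mem hx
    have ht' := h.isSubgroup.inv_mem ht
    refine ⟨hx', P.inv t, ht', ?_⟩
    have h1 := h.mem_D_mid hx ht' m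
    have h2 := h.mem_D_right ht ht' m
    have h3 : [P.inv x.val, x.val, P.mul m (P.inv t)] ∈ P.D :=
      hP.wInv_append_append (u := [x.val]) (v := [_]) (hP.pi_cons h1).1
    have key : β m = β (P.mul x.val (P.mul m (P.inv t))) := by
      rw [← hP.mul_assoc' h1]
      refine (congrArg β (hP.mul_inv_cancel' (hP.append_left [m, t] _ h2)).symm).trans ?_
      exact hβ.mul_congr (hP.pi_pair_cons h2).1 (hP.pi_pair_cons h1).1 hxt.symm rfl
    have e := hP.inv_mul_cancel' (hP.pi_cons h1).1
    change P.mul _ (P.mul _ (P.mul m (P.inv t))) = P.mul m (P.inv t) at e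
    rw [← e]
    exact hβ.mul_congr (hP.append_left [_, m] [P.inv t] (h.mem_D_mid hx' ht' m))
      (hP.pi_cons h3).1 rfl key

/-- The element `m` is defined on every element of `S` whose image under `β` is conjugated into
`βS` by `βm`. -/
def Good (P : Data L) (S : Set L) (β : L → L') (m : L) : Prop :=
  ∀ x ∈ S, ∀ t ∈ S, β (P.mul x m) = β (P.mul m t) → x ∈ P.SOf S m

/-- Every fibre of the restriction of `β` to a normal set contains a good element. -/
theorem exists_good (hp : p.Prime) (h : IsLocality p P Δ S) (hP' : IsPartialGroup P')
    (hN : P.IsNormalSet N) (hβ : IsHom P P' β) {n : L} (hn : n ∈ N) :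
    ∃ m ∈ N, β m = β n ∧ Good P S β m := by
  have hP := h.isPartialGroup
  have : Nonempty L := ⟨n⟩
  have hK := hβ.isNormalSet_ker hP hP'
  have hM := hK.inter hN
  obtain ⟨k, hnk, hmax⟩ := exists_link_maximal hp h hM n
  have hk : k ∈ N ∧ β k = β n := by
    obtain ⟨m, hm, hD, rfl⟩ := hnk.mul_mem h
    exact ⟨hN.mul_mem hn hm.2 hD,
      (hβ.mul_congr hD (hP.mul_one' n).1 rfl (hm.1.trans hK.one_mem.symm)).trans
        (congrArg β (hP.mul_one' n).2)⟩
  refine ⟨k, hk.1, hk.2, ?_⟩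
  by_contra hgood
  let X : h.Obj := ⟨_, (h.step_SOf k).left⟩
  have hlt : objSubgroup X < h.fibreDom hβ k := by
    refine lt_of_le_not_ge (fun x hx => ?_) fun hle => hgood fun x hx t ht hxt => ?_
    · exact ⟨h.subset_S X.mem hx, _, hx.2.2, congrArg β (hP.mul_conj_eq hx.2.1).2.symm⟩
    · exact @hle (h.ofS hx) ⟨hx, t, ht, hxt⟩
  obtain ⟨x, ⟨hxS, t, ht, hxt⟩, hx, hxk⟩ := exists_mem_nsObj hp
    (B := h.fibreDom hβ k) (fun _ hx => hx.1) hlt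
  have st := (mem_nsObj.1 hx).2
  have hc := mul_inv_conj_mem h hN hk.1 hxS st
  refine hxk (hmax x.val hxS st ?_)
  refine exists_inv_mul_mem hp h hP' hN hK hβ
    (h.isSubgroup.mul_mem (h.isSubgroup.inv_mem hxS) ht) hc.2 ?_
  refine hβ.mul_congr hc.1 (h.isSubgroup.pair_mem (h.isSubgroup.inv_mem hxS) ht) rfl ?_
  have hD := h.mem_Dconj_of_step (h.step_SOf k) st
  have h1 : [k, t] ∈ P.D := h.mem_D₂ (h.step_SOf k) (h.step_of_mem_S (h.step_SOf k).right ht)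
  have h2 : [P.inv k, k, t] ∈ P.D := hP.wInv_append_append (u := [k]) (v := [t]) h1
  rw [hP.conj_eq hD, ← hP.inv_mul_cancel' h1]
  exact hβ.mul_congr (hP.pi_cons hD).1 (hP.pi_cons h2).1 rfl hxt

end IsLocality

namespace IsLocality

variable {P' : Data L'} {β : L → L'} {p : ℕ} {P : Data L} {Δ : Set (Set L)} {S : Set L}

/-- The elements of `S` with the same image under `β` as an element of `Q`. -/
def saturation (S : Set L) (β : L → L') (Q : Set L) : Set L := {x | x ∈ S ∧ β x ∈ β '' Q}

theorem subset_saturation (h : IsLocality p P Δ S) {Q : Set L} (hQ : Q ∈ Δ) :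
    Q ⊆ saturation S β Q :=
  fun _ hx => ⟨h.subset_S hQ hx, Set.mem_image_of_mem β hx⟩

/-- A step along `g` lifts to a step along any good element in the same fibre. -/
theorem step_of_good (h : IsLocality p P Δ S) (hP' : IsPartialGroup P') (hβ : IsHom P P' β)
    {Q R Q₁ : Set L} {g m : L} (hQ₁ : Q₁ ∈ Δ) (hsat : Q₁ ⊆ saturation S β Q)
    (s : Step P Δ Q g R) (hm : Good P S β m) (hmg : β m = β g) :
    ∃ R₁, Step P Δ Q₁ m R₁ ∧ R₁ ⊆ saturation S β R := by
  have hP := h.isPartialGroup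
  have hsub : Q₁ ⊆ P.SOf S m := by
    intro x hx
    obtain ⟨hxS, q, hq, hqx⟩ := hsat hx
    have hqS := h.subset_S s.left hq
    have ht := h.subset_S s.right (s.conj_mem hq)
    refine hm x hxS _ ht ?_
    have e := hP.mul_conj_eq (s.sub hq)
    refine (hβ.mul_congr (hP.append_left [x, m] _ (h.mem_D_mid hxS hxS m))
      (hP.append_left [q, g] _ (h.mem_D_mid hqS hqS g)) hqx.symm hmg).trans ?_
    rw [← e.2]
    exact hβ.mul_congr e.1 (hP.append_right [x] _ (h.mem_D_mid hxS ht m)) hmg.symm rfl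
  have st := h.step_of_subset_SOf hQ₁ hsub
  refine ⟨_, st, ?_⟩
  rintro _ ⟨x, hx, rfl⟩
  obtain ⟨-, q, hq, hqx⟩ := hsat hx
  exact ⟨(hsub hx).2.2, _, s.conj_mem hq,
    hβ.conj_congr hP hP' (s.sub hq) (st.sub hx) hqx hmg.symm⟩

theorem mul_mem_image (hp : p.Prime) (h : IsLocality p P Δ S) (hP' : IsPartialGroup P')
    (hβ : IsProjection P P' β) {N : Set L} (hN : P.IsNormalSet N) {a b : L} (ha : a ∈ N)
    (hb : b ∈ N) (hD : [β a, β b] ∈ P'.D) : P'.mul (β a) (β b) ∈ β '' N := by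
  obtain ⟨w, hw, he⟩ := hβ.2 _ hD
  obtain ⟨f, g, rfl, hf, hg⟩ : ∃ f g, w = [f, g] ∧ β f = β a ∧ β g = β b := by
    simpa [List.map_eq_cons_iff, and_assoc] using he
  obtain ⟨Q, R, U, s, t⟩ := h.exists_step₂ hw
  obtain ⟨m, hm, hma, hmg⟩ := exists_good hp h hP' hN hβ.1 ha
  obtain ⟨n, hn, hnb, hng⟩ := exists_good hp h hP' hN hβ.1 hb
  obtain ⟨R₁, s₁, hR₁⟩ := h.step_of_good hP' hβ.1 s.left (h.subset_saturation s.left) s hmg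
    (hma.trans hf.symm)
  obtain ⟨U₁, t₁, -⟩ := h.step_of_good hP' hβ.1 s₁.right hR₁ t hng (hnb.trans hg.symm)
  have hD₁ := h.mem_D₂ s₁ t₁
  refine ⟨_, hN.mul_mem hm hn hD₁, ?_⟩
  rw [(hβ.1.map_mul hD₁).2, hma, hnb]

theorem conj_mem_image (hp : p.Prime) (h : IsLocality p P Δ S) (hP' : IsPartialGroup P')
    (hβ : IsProjection P P' β) {N : Set L} (hN : P.IsNormalSet N) {n : L} (hn : n ∈ N) {f' : L'}
    (hD : β n ∈ P'.Dconj f') : P'.conj (β n) f' ∈ β '' N := by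
  have hP := h.isPartialGroup
  obtain ⟨w, hw, he⟩ := hβ.2 _ hD
  obtain ⟨f, g, k, rfl, hf, hg, rfl⟩ :
      ∃ f g k, w = [f, g, k] ∧ β f = P'.inv f' ∧ β g = β n ∧ β k = f' := by
    simpa [List.map_eq_cons_iff, and_assoc] using he
  obtain ⟨Q, R, U, V, s, t, u⟩ := h.exists_step₃ hw
  obtain ⟨m, hm, hmn, hmg⟩ := exists_good hp h hP' hN hβ.1 hn
  obtain ⟨l, -, hlk, hlg⟩ := exists_good hp h hP' Data.isNormalSet_univ hβ.1 (Set.mem_univ k)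
  obtain ⟨Q₁, s₁, -⟩ := h.step_of_good hP' hβ.1 s.right (h.subset_saturation s.right)
    (h.step_inv s) hlg (by rw [hβ.1.map_inv hP hP', hf, hP'.inv_inv, hlk])
  obtain ⟨U₁, t₁, hU₁⟩ := h.step_of_good hP' hβ.1 s.right (h.subset_saturation s.right) t hmg
    (hmn.trans hg.symm)
  obtain ⟨V₁, u₁, -⟩ := h.step_of_good hP' hβ.1 t₁.right hU₁ u hlg hlk
  have hD₁ : m ∈ P.Dconj l := h.mem_D₃ (h.step_inv s₁) t₁ u₁
  refine ⟨_, hN.conj_mem hm hD₁, ?_⟩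
  have := hβ.1.2 _ hD₁
  simp only [List.map_cons, List.map_nil, hβ.1.map_inv hP hP', hmn, hlk] at this
  exact this.symm

end IsLocality

/-- Lemma 3.11: if `(L,Δ,S)` is a locality, `L'` a partial group, and `β : L → L'` a
projection of partial groups, then the image of a partial normal subgroup `N` of `L`
is a partial normal subgroup of `L'`. -/
theorem partialNormal_image (p : ℕ) (hp : p.Prime) (P : Data L) (Δ : Set (Set L))
    (S : Set L) (hloc : IsLocality p P Δ S) (P' : Data L') (hP' : IsPartialGroup P')
    (β : L → L') (hβ : IsProjection P P' β) (N : Set L) (hN : P.IsPartialNormal N) :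
    P'.IsPartialNormal (β '' N) := by
  have hP := hloc.isPartialGroup
  have : Nonempty L := ⟨P.one⟩
  have hN' := hN.isNormalSet hP
  refine ⟨⟨?_, hP'.pi_mem ⟨_, hN'.one_mem, hβ.1.map_one P.one hP⟩ ?_⟩, ?_⟩
  · rintro _ ⟨n, hn, rfl⟩
    exact ⟨_, hN'.inv_mem hn, hβ.1.map_inv hP hP' n⟩
  · rintro _ ⟨a, ha, rfl⟩ _ ⟨b, hb, rfl⟩ hD
    exact hloc.mul_mem_image hp hP' hβ hN' ha hb hD
  · rintro f' _ ⟨n, hn, rfl⟩ hD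
    exact hloc.conj_mem_image hp hP' hβ hN' hn hD

end PartialGroups
end

section
/- Let L be a partial group with product Π : D → L, let L_1 and L_2 be partial subgroups of L, and consider the map φ : L_1 × L_2 → L, (f,g) ↦ Π(f,g), from the external direct product, which is well-defined provided (f,g) ∈ D for all f ∈ L_1 and g ∈ L_2. Then: (a) φ is well-defined and a projection of partial groups if and only if L is the internal central product of L_1 and L_2; (b) if φ is well-defined and a projection of partial groups, then ker(φ) = {(f,f⁻¹) : f ∈ L_1 ∩ L_2} ⊆ Z(L_1 × L_2) and ker(φ) ∩ L_iι_i = {1} for i = 1,2; (c) φ is well-defined and an isomorphism of partial groups if and only if L is the internal direct product of L_1 and L_2; (d) if φ is well-defined, then (L_iι_i)φ = L_i and the map L_iι_i → L_i induced by φ is an isomorphism of partial groups for i = 1,2. -/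
/-!
Background definitions for partial groups and localities in the sense of Chermak.

A *partial group* is given by `Data`: a domain `D` of words, a (total, but only
meaningful on `D`) product `pi : List L → L`, and an inversion map, subject to the
axioms collected in `IsPartialGroup`.
-/

namespace PartialGroups

variable {L L' L₁ L₂ L₁' L₂' : Type*}

namespace IsPartialGroup

variable {P : Data L}

theorem nil_mem_s19 (hP : IsPartialGroup P) : [] ∈ P.D :=
  hP.append_left [] [P.one] (hP.singleton_mem P.one)

theorem insert_one_mem (hP : IsPartialGroup P) (u v : List L) (h : u ++ v ∈ P.D) :
    u ++ P.one :: v ∈ P.D := by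
  simpa [Data.one] using hP.assoc_mem u [] v (by simpa using h)

theorem pi_insert_one (hP : IsPartialGroup P) (u v : List L) (h : u ++ v ∈ P.D) :
    P.pi (u ++ P.one :: v) = P.pi (u ++ v) := by
  simpa [Data.one] using (hP.assoc_pi u [] v (by simpa using h)).symm

theorem mul_one_mem (hP : IsPartialGroup P) (f : L) : [f, P.one] ∈ P.D :=
  hP.insert_one_mem [f] [] (hP.singleton_mem f)

theorem one_mul_mem (hP : IsPartialGroup P) (f : L) : [P.one, f] ∈ P.D :=
  hP.insert_one_mem [] [f] (hP.singleton_mem f)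

theorem pi_mul_one (hP : IsPartialGroup P) (f : L) : P.pi [f, P.one] = f :=
  (hP.pi_insert_one [f] [] (hP.singleton_mem f)).trans (hP.pi_singleton f)

theorem pi_one_mul (hP : IsPartialGroup P) (f : L) : P.pi [P.one, f] = f :=
  (hP.pi_insert_one [] [f] (hP.singleton_mem f)).trans (hP.pi_singleton f)

theorem one_conj_mem (hP : IsPartialGroup P) (f : L) : [P.one, f, P.one] ∈ P.D :=
  hP.insert_one_mem [] _ (hP.mul_one_mem f)

theorem pi_one_conj (hP : IsPartialGroup P) (f : L) : P.pi [P.one, f, P.one] = f :=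
  (hP.pi_insert_one [] _ (hP.mul_one_mem f)).trans (hP.pi_mul_one f)

theorem inv_mul_mem (hP : IsPartialGroup P) (f : L) : [P.inv f, f] ∈ P.D := by
  simpa [Data.wInv] using hP.wInv_mem [f] (hP.singleton_mem f)

theorem pi_inv_mul (hP : IsPartialGroup P) (f : L) : P.pi [P.inv f, f] = P.one := by
  simpa [Data.wInv] using hP.wInv_pi [f] (hP.singleton_mem f)

theorem mul_inv_mem (hP : IsPartialGroup P) (f : L) : [f, P.inv f] ∈ P.D := by
  simpa [hP.inv_inv] using hP.inv_mul_mem (P.inv f)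

theorem pi_mul_inv (hP : IsPartialGroup P) (f : L) : P.pi [f, P.inv f] = P.one := by
  simpa [hP.inv_inv] using hP.pi_inv_mul (P.inv f)

theorem conj_one_mem (hP : IsPartialGroup P) (f : L) : [P.inv f, P.one, f] ∈ P.D :=
  hP.insert_one_mem [P.inv f] [f] (hP.inv_mul_mem f)

theorem pi_conj_one (hP : IsPartialGroup P) (f : L) : P.pi [P.inv f, P.one, f] = P.one :=
  (hP.pi_insert_one [P.inv f] [f] (hP.inv_mul_mem f)).trans (hP.pi_inv_mul f)

theorem replicate_one_mem (hP : IsPartialGroup P) (n : ℕ) : List.replicate n P.one ∈ P.D := by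
  induction n with
  | zero => exact hP.nil_mem_s19
  | succ n ih => exact hP.insert_one_mem [] _ ih

theorem pi_replicate_one (hP : IsPartialGroup P) (n : ℕ) :
    P.pi (List.replicate n P.one) = P.one := by
  induction n with
  | zero => rfl
  | succ n ih => exact (hP.pi_insert_one [] _ (hP.replicate_one_mem n)).trans ih

theorem eq_inv_of_pi_eq_one (hP : IsPartialGroup P) {f g : L} (h : [f, g] ∈ P.D)
    (h_one : P.pi [f, g] = P.one) : g = P.inv f := by
  have h4 : [P.inv g] ++ [P.inv f, f, g] ∈ P.D := by
    simpa [Data.wInv] using hP.wInv_mem _ h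
  have h3 : [P.inv f, f, g] ∈ P.D := hP.append_right _ _ h4
  have h_left := hP.assoc_pi [] [P.inv f, f] [g] h3
  have h_right := hP.assoc_pi [P.inv f] [f, g] [] h3
  simp only [List.nil_append, List.cons_append, List.append_nil, hP.pi_inv_mul,
    hP.pi_one_mul, h_one, hP.pi_mul_one] at h_left h_right
  exact h_left.symm.trans h_right

theorem one_mem (hP : IsPartialGroup P) {H : Set L} (hH : P.IsPartialSubgroup H) : P.one ∈ H :=
  hH.2 [] ⟨by simp [Wrd], hP.nil_mem_s19⟩

end IsPartialGroup

section MulMap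

variable {P : Data L} {M₁ M₂ : Set L}

/-- The map `(f, g) ↦ Π(f, g)`. -/
def Data.mulMap (P : Data L) (x : L × L) : L := P.pi [x.1, x.2]

theorem map_mulMap (P : Data L) (w : List (L × L)) :
    w.map P.mulMap = zipProd P (w.map Prod.fst) (w.map Prod.snd) := by
  induction w with
  | nil => rfl
  | cons a w ih =>
    simp only [zipProd, Data.mulMap, List.map_cons, List.zipWith_cons_cons] at ih ⊢
    rw [ih]

theorem zipProd_eq_map_zip (P : Data L) (u v : List L) :
    zipProd P u v = (u.zip v).map P.mulMap := by
  simp [zipProd, List.zip, Data.mulMap, List.map_zipWith]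

theorem mem_prodData_inter_Wrd_iff {w : List (L × L)} :
    w ∈ (prodData P P).D ∩ Wrd (M₁ ×ˢ M₂) ↔
      w.map Prod.fst ∈ P.D ∩ Wrd M₁ ∧ w.map Prod.snd ∈ P.D ∩ Wrd M₂ := by
  simp only [prodData, Wrd, Set.mem_inter_iff, Set.mem_ofPred_eq, Set.mem_prod, List.mem_map,
    forall_exists_index, and_imp, forall_apply_eq_imp_iff₂]
  grind

theorem zip_mem_prodData {u v : List L} (hu : u ∈ P.D ∩ Wrd M₁) (hv : v ∈ P.D ∩ Wrd M₂)
    (h_len : u.length = v.length) : u.zip v ∈ (prodData P P).D ∩ Wrd (M₁ ×ˢ M₂) := by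
  rw [mem_prodData_inter_Wrd_iff, List.map_fst_zip h_len.le, List.map_snd_zip h_len.ge]
  exact ⟨hu, hv⟩

theorem zip_pairs_mem (hD : ∀ f ∈ M₁, ∀ g ∈ M₂, [f, g] ∈ P.D) {u v : List L}
    (hu : u ∈ Wrd M₁) (hv : v ∈ Wrd M₂) : ∀ q ∈ u.zip v, [q.1, q.2] ∈ P.D :=
  fun _ hq => hD _ (hu _ (List.of_mem_zip hq).1) _ (hv _ (List.of_mem_zip hq).2)

theorem IsInternalCentralProduct.pair_mem (hP : IsPartialGroup P)
    (h₁ : P.IsPartialSubgroup M₁) (h₂ : P.IsPartialSubgroup M₂)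
    (h : IsInternalCentralProduct P M₁ M₂) : ∀ f ∈ M₁, ∀ g ∈ M₂, [f, g] ∈ P.D := by
  intro f hf g hg
  rw [h.1]
  refine ⟨[f, P.one], [P.one, g], ⟨hP.mul_one_mem f, ?_⟩, ⟨hP.one_mul_mem g, ?_⟩, rfl, ?_, ?_⟩
  · simp [Wrd, hf, hP.one_mem h₁]
  · simp [Wrd, hg, hP.one_mem h₂]
  · simp [hP.mul_one_mem, hP.one_mul_mem]
  · simp [zipProd, hP.pi_mul_one, hP.pi_one_mul]

theorem isProjBetween_mulMap_iff (hP : IsPartialGroup P)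
    (h₁ : P.IsPartialSubgroup M₁) (h₂ : P.IsPartialSubgroup M₂) :
    ((∀ f ∈ M₁, ∀ g ∈ M₂, [f, g] ∈ P.D) ∧
      IsProjBetween (prodData P P) P (M₁ ×ˢ M₂) Set.univ P.mulMap) ↔
      IsInternalCentralProduct P M₁ M₂ := by
  constructor
  · rintro ⟨hD, -, ⟨h_dom, h_pi⟩, h_lift⟩
    refine ⟨Set.ext fun w => ⟨fun hw => ?_, ?_⟩, fun u v hu hv h_len _ => ?_⟩
    · obtain ⟨x, hx, rfl⟩ := h_lift w ⟨hw, fun _ _ => trivial⟩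
      obtain ⟨hx₁, hx₂⟩ := mem_prodData_inter_Wrd_iff.1 hx
      exact ⟨_, _, hx₁, hx₂, by simp, zip_pairs_mem hD hx₁.2 hx₂.2, map_mulMap P x⟩
    · rintro ⟨u, v, hu, hv, h_len, -, rfl⟩
      rw [zipProd_eq_map_zip]
      exact h_dom _ (zip_mem_prodData hu hv h_len)
    · rw [zipProd_eq_map_zip, h_pi _ (zip_mem_prodData hu hv h_len)]
      simp only [prodData, Data.mulMap, List.map_fst_zip h_len.le, List.map_snd_zip h_len.ge]
  · intro h
    have hD := h.pair_mem hP h₁ h₂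
    refine ⟨hD, Set.eq_univ_of_forall fun x => ?_, ⟨fun w hw => ?_, fun w hw => ?_⟩, ?_⟩
    · have hx := hP.singleton_mem x
      rw [h.1] at hx
      obtain ⟨u, v, hu, hv, h_len, -, h_eq⟩ := hx
      rw [zipProd_eq_map_zip, eq_comm, List.map_eq_singleton_iff] at h_eq
      obtain ⟨a, ha, rfl⟩ := h_eq
      exact ⟨a, (zip_mem_prodData hu hv h_len).2 a (by simp [ha]), rfl⟩
    · obtain ⟨hw₁, hw₂⟩ := mem_prodData_inter_Wrd_iff.1 hw
      rw [h.1]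
      exact ⟨_, _, hw₁, hw₂, by simp, zip_pairs_mem hD hw₁.2 hw₂.2, map_mulMap P w⟩
    · obtain ⟨hw₁, hw₂⟩ := mem_prodData_inter_Wrd_iff.1 hw
      rw [map_mulMap]
      exact h.2 _ _ hw₁ hw₂ (by simp) (zip_pairs_mem hD hw₁.2 hw₂.2)
    · rintro w ⟨hw, -⟩
      rw [h.1] at hw
      obtain ⟨u, v, hu, hv, h_len, -, rfl⟩ := hw
      exact ⟨u.zip v, zip_mem_prodData hu hv h_len, (zipProd_eq_map_zip P u v).symm⟩

theorem IsHomBetween.conj_right (hP : IsPartialGroup P)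
    (h₁ : P.IsPartialSubgroup M₁) (h₂ : P.IsPartialSubgroup M₂)
    (h : IsHomBetween (prodData P P) P (M₁ ×ˢ M₂) P.mulMap) {f g : L} (hf : f ∈ M₁)
    (hg : g ∈ M₂) : f ∈ P.Dconj g ∧ P.conj f g = f := by
  have hw : [(P.one, P.inv g), (f, P.one), (P.one, g)] ∈
      (prodData P P).D ∩ Wrd (M₁ ×ˢ M₂) := by
    rw [mem_prodData_inter_Wrd_iff]
    exact ⟨⟨hP.one_conj_mem f, by simp [Wrd, hP.one_mem h₁, hf]⟩,
      ⟨hP.conj_one_mem g, by simp [Wrd, hP.one_mem h₂, hg, h₂.1]⟩⟩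
  have h_mem := h.1 _ hw
  have h_pi := h.2 _ hw
  simp only [List.map_cons, List.map_nil, Data.mulMap, prodData, hP.pi_one_mul, hP.pi_mul_one,
    hP.pi_one_conj, hP.pi_conj_one] at h_mem h_pi
  exact ⟨h_mem, h_pi⟩

theorem IsHomBetween.conj_left (hP : IsPartialGroup P)
    (h₁ : P.IsPartialSubgroup M₁) (h₂ : P.IsPartialSubgroup M₂)
    (h : IsHomBetween (prodData P P) P (M₁ ×ˢ M₂) P.mulMap) {f g : L} (hf : f ∈ M₁)
    (hg : g ∈ M₂) : g ∈ P.Dconj f ∧ P.conj g f = g := by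
  have hw : [(P.inv f, P.one), (P.one, g), (f, P.one)] ∈
      (prodData P P).D ∩ Wrd (M₁ ×ˢ M₂) := by
    rw [mem_prodData_inter_Wrd_iff]
    exact ⟨⟨hP.conj_one_mem f, by simp [Wrd, hP.one_mem h₁, hf, h₁.1]⟩,
      ⟨hP.one_conj_mem g, by simp [Wrd, hP.one_mem h₂, hg]⟩⟩
  have h_mem := h.1 _ hw
  have h_pi := h.2 _ hw
  simp only [List.map_cons, List.map_nil, Data.mulMap, prodData, hP.pi_one_mul, hP.pi_mul_one,
    hP.pi_one_conj, hP.pi_conj_one] at h_mem h_pi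
  exact ⟨h_mem, h_pi⟩

theorem mulMap_ker_eq (hP : IsPartialGroup P)
    (h₂ : P.IsPartialSubgroup M₂) (hD : ∀ f ∈ M₁, ∀ g ∈ M₂, [f, g] ∈ P.D) :
    {x ∈ M₁ ×ˢ M₂ | P.mulMap x = P.one} =
      {y : L × L | ∃ f ∈ M₁ ∩ M₂, y = (f, P.inv f)} := by
  ext ⟨f, g⟩
  constructor
  · rintro ⟨⟨hf, hg⟩, h_one⟩
    obtain rfl : g = P.inv f := hP.eq_inv_of_pi_eq_one (hD f hf g hg) h_one
    exact ⟨f, ⟨hf, by simpa [hP.inv_inv] using h₂.1 _ hg⟩, rfl⟩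
  · rintro ⟨f', ⟨hf₁, hf₂⟩, h_eq⟩
    rw [h_eq]
    exact ⟨⟨hf₁, h₂.1 _ hf₂⟩, hP.pi_mul_inv f'⟩

theorem inv_pair_mem_centerIn (hP : IsPartialGroup P) (h₁ : P.IsPartialSubgroup M₁)
    (h₂ : P.IsPartialSubgroup M₂)
    (h : IsHomBetween (prodData P P) P (M₁ ×ˢ M₂) P.mulMap) {f : L} (hf : f ∈ M₁ ∩ M₂) :
    (f, P.inv f) ∈ (prodData P P).centerIn (M₁ ×ˢ M₂) := by
  refine ⟨⟨hf.1, h₂.1 _ hf.2⟩, ?_⟩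
  rintro ⟨a, b⟩ ⟨ha, hb⟩
  obtain ⟨ha_mem, ha_eq⟩ := h.conj_right hP h₁ h₂ ha hf.2
  obtain ⟨hb_mem, hb_eq⟩ := h.conj_left hP h₁ h₂ (h₁.1 _ hf.1) hb
  exact ⟨⟨ha_mem, hb_mem⟩, Prod.ext ha_eq hb_eq⟩

theorem isIsoBetween_of_leftInverse {Q : Data L'} {ι : L → L'} {β : L' → L}
    (hβ : Function.LeftInverse β ι) (h_dom : ∀ u, u.map ι ∈ Q.D ↔ u ∈ P.D)
    (h_pi : ∀ u, Q.pi (u.map ι) = ι (P.pi u)) (M : Set L) :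
    IsIsoBetween Q P (ι '' M) M β := by
  have h_map : ∀ u : List L, (u.map ι).map β = u := fun u => by
    simp [List.map_map, hβ.comp_eq_id]
  have h_lift : ∀ w ∈ Wrd (ι '' M), (w.map β).map ι = w := fun w hw => by
    rw [List.map_map]
    refine (List.map_congr_left fun x hx => ?_).trans (List.map_id w)
    obtain ⟨f, -, rfl⟩ := hw x hx
    exact congrArg ι (hβ f)
  refine ⟨⟨hβ.image_image M, ⟨?_, ?_⟩, ?_⟩, ?_⟩
  · rintro w ⟨hw, hw_mem⟩
    rw [← h_lift w hw_mem] at hw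
    exact (h_dom _).1 hw
  · rintro w ⟨-, hw_mem⟩
    rw [← h_lift w hw_mem, h_map, h_pi, hβ]
  · rintro u ⟨hu, hu_mem⟩
    refine ⟨u.map ι, ⟨(h_dom u).2 hu, fun x hx => ?_⟩, h_map u⟩
    obtain ⟨f, hf, rfl⟩ := List.mem_map.1 hx
    exact ⟨f, hu_mem f hf, rfl⟩
  · rintro - ⟨f, -, rfl⟩ - ⟨g, -, rfl⟩ h_eq
    rw [hβ, hβ] at h_eq
    rw [h_eq]

theorem isIsoBetween_mulMap_inl (hP : IsPartialGroup P) (M : Set L) :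
    IsIsoBetween (prodData P P) P ((fun f : L => (f, P.one)) '' M) M P.mulMap :=
  isIsoBetween_of_leftInverse (ι := fun f : L => (f, P.one)) (β := P.mulMap)
    hP.pi_mul_one
    (fun u => by simp [prodData, Function.comp_def, hP.replicate_one_mem])
    (fun u => by simp [prodData, Function.comp_def, hP.pi_replicate_one]) M

theorem isIsoBetween_mulMap_inr (hP : IsPartialGroup P) (M : Set L) :
    IsIsoBetween (prodData P P) P ((fun g : L => (P.one, g)) '' M) M P.mulMap :=
  isIsoBetween_of_leftInverse (ι := fun g : L => (P.one, g)) (β := P.mulMap)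
    hP.pi_one_mul
    (fun u => by simp [prodData, Function.comp_def, hP.replicate_one_mem])
    (fun u => by simp [prodData, Function.comp_def, hP.pi_replicate_one]) M

theorem IsInternalCentralProduct.injOn_mulMap_iff (hP : IsPartialGroup P)
    (h₁ : P.IsPartialSubgroup M₁) (h₂ : P.IsPartialSubgroup M₂)
    (h : IsInternalCentralProduct P M₁ M₂) :
    Set.InjOn P.mulMap (M₁ ×ˢ M₂) ↔
      ∀ h : L, ∃! fg : L × L, fg.1 ∈ M₁ ∧ fg.2 ∈ M₂ ∧ [fg.1, fg.2] ∈ P.D ∧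
        P.pi [fg.1, fg.2] = h := by
  obtain ⟨hD, h_image, -⟩ := (isProjBetween_mulMap_iff hP h₁ h₂).2 h
  constructor
  · intro h_inj y
    obtain ⟨x, hx, rfl⟩ : y ∈ P.mulMap '' (M₁ ×ˢ M₂) := h_image ▸ Set.mem_univ y
    exact ⟨x, ⟨hx.1, hx.2, hD _ hx.1 _ hx.2, rfl⟩,
      fun z hz => h_inj ⟨hz.1, hz.2.1⟩ hx hz.2.2.2⟩
  · intro h_unique x hx y hy h_eq
    exact (h_unique (P.mulMap y)).unique ⟨hx.1, hx.2, hD _ hx.1 _ hx.2, h_eq⟩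
      ⟨hy.1, hy.2, hD _ hy.1 _ hy.2, rfl⟩

end MulMap

/-- Proposition 6.5: for partial subgroups `M₁, M₂` of `L` consider
`φ : M₁ × M₂ → L, (f,g) ↦ Π(f,g)` (well-defined iff `(f,g) ∈ D` for all `f ∈ M₁`,
`g ∈ M₂`).  Then: (a) `φ` is well-defined and a projection of partial groups iff
`L` is the internal central product of `M₁` and `M₂`; (b) in that case
`ker(φ) = {(f,f⁻¹) : f ∈ M₁ ∩ M₂} ⊆ Z(M₁ × M₂)` and `ker(φ) ∩ M_iι_i = {1}`;
(c) `φ` is well-defined and an isomorphism of partial groups iff `L` is the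
internal direct product of `M₁` and `M₂`; (d) if `φ` is well-defined then
`(M_iι_i)φ = M_i` and the map `M_iι_i → M_i` induced by `φ` is an isomorphism of
partial groups. -/
theorem internalCentralProduct_phi (P : Data L) (hP : IsPartialGroup P)
    (M₁ M₂ : Set L) (h₁ : P.IsPartialSubgroup M₁) (h₂ : P.IsPartialSubgroup M₂) :
    -- (a)
    (((∀ f ∈ M₁, ∀ g ∈ M₂, [f, g] ∈ P.D) ∧
        IsProjBetween (prodData P P) P (M₁ ×ˢ M₂) Set.univ
          (fun x : L × L => P.pi [x.1, x.2])) ↔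
      IsInternalCentralProduct P M₁ M₂) ∧
    -- (b)
    (((∀ f ∈ M₁, ∀ g ∈ M₂, [f, g] ∈ P.D) ∧
        IsProjBetween (prodData P P) P (M₁ ×ˢ M₂) Set.univ
          (fun x : L × L => P.pi [x.1, x.2])) →
      ({x ∈ M₁ ×ˢ M₂ | P.pi [x.1, x.2] = P.one} =
          {y : L × L | ∃ f ∈ M₁ ∩ M₂, y = (f, P.inv f)} ∧
       {x ∈ M₁ ×ˢ M₂ | P.pi [x.1, x.2] = P.one} ⊆
          (prodData P P).centerIn (M₁ ×ˢ M₂) ∧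
       {x ∈ M₁ ×ˢ M₂ | P.pi [x.1, x.2] = P.one} ∩
          ((fun f : L => (f, P.one)) '' M₁) = {(P.one, P.one)} ∧
       {x ∈ M₁ ×ˢ M₂ | P.pi [x.1, x.2] = P.one} ∩
          ((fun g : L => (P.one, g)) '' M₂) = {(P.one, P.one)})) ∧
    -- (c)
    (((∀ f ∈ M₁, ∀ g ∈ M₂, [f, g] ∈ P.D) ∧
        IsIsoBetween (prodData P P) P (M₁ ×ˢ M₂) Set.univ
          (fun x : L × L => P.pi [x.1, x.2])) ↔
      IsInternalDirectProduct P M₁ M₂) ∧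
    -- (d)
    ((∀ f ∈ M₁, ∀ g ∈ M₂, [f, g] ∈ P.D) →
      ((fun x : L × L => P.pi [x.1, x.2]) '' ((fun f : L => (f, P.one)) '' M₁) = M₁ ∧
       IsIsoBetween (prodData P P) P ((fun f : L => (f, P.one)) '' M₁) M₁
         (fun x : L × L => P.pi [x.1, x.2]) ∧
       (fun x : L × L => P.pi [x.1, x.2]) '' ((fun g : L => (P.one, g)) '' M₂) = M₂ ∧
       IsIsoBetween (prodData P P) P ((fun g : L => (P.one, g)) '' M₂) M₂
         (fun x : L × L => P.pi [x.1, x.2]))) := by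
  change ((_ ∧ IsProjBetween _ P _ _ P.mulMap) ↔ _) ∧
    ((_ ∧ IsProjBetween _ P _ _ P.mulMap) →
      ({x ∈ M₁ ×ˢ M₂ | P.mulMap x = P.one} = _ ∧ {x ∈ M₁ ×ˢ M₂ | P.mulMap x = P.one} ⊆ _ ∧
        {x ∈ M₁ ×ˢ M₂ | P.mulMap x = P.one} ∩ _ = _ ∧
        {x ∈ M₁ ×ˢ M₂ | P.mulMap x = P.one} ∩ _ = _)) ∧
    ((_ ∧ IsIsoBetween _ P _ _ P.mulMap) ↔ _) ∧
    (_ → (P.mulMap '' _ = _ ∧ IsIsoBetween _ P _ _ P.mulMap ∧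
      P.mulMap '' _ = _ ∧ IsIsoBetween _ P _ _ P.mulMap))
  have h_iff := isProjBetween_mulMap_iff hP h₁ h₂
  refine ⟨h_iff, ?_, ⟨?_, ?_⟩, fun _ => ?_⟩
  · rintro ⟨hD, -, h_hom, -⟩
    have h_one : P.mulMap (P.one, P.one) = P.one := hP.pi_mul_one P.one
    have h_one_mem : (P.one, P.one) ∈ M₁ ×ˢ M₂ := ⟨hP.one_mem h₁, hP.one_mem h₂⟩
    refine ⟨mulMap_ker_eq hP h₂ hD, ?_, ?_, ?_⟩
    · rw [mulMap_ker_eq hP h₂ hD]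
      rintro - ⟨f, hf, rfl⟩
      exact inv_pair_mem_centerIn hP h₁ h₂ h_hom hf
    · refine Set.Subset.antisymm ?_ ?_
      · rintro - ⟨⟨-, h_eq⟩, f, -, rfl⟩
        obtain rfl : f = P.one := (hP.pi_mul_one f).symm.trans h_eq
        rfl
      · rintro - rfl
        exact ⟨⟨h_one_mem, h_one⟩, P.one, h_one_mem.1, rfl⟩
    · refine Set.Subset.antisymm ?_ ?_
      · rintro - ⟨⟨-, h_eq⟩, g, -, rfl⟩
        obtain rfl : g = P.one := (hP.pi_one_mul g).symm.trans h_eq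
        rfl
      · rintro - rfl
        exact ⟨⟨h_one_mem, h_one⟩, P.one, h_one_mem.2, rfl⟩
  · rintro ⟨hD, h_proj, h_inj⟩
    have h_central := h_iff.1 ⟨hD, h_proj⟩
    exact ⟨h_central, (h_central.injOn_mulMap_iff hP h₁ h₂).1 h_inj⟩
  · rintro ⟨h_central, h_unique⟩
    obtain ⟨hD, h_proj⟩ := h_iff.2 h_central
    exact ⟨hD, h_proj, (h_central.injOn_mulMap_iff hP h₁ h₂).2 h_unique⟩
  · have h_inl := isIsoBetween_mulMap_inl hP M₁
    have h_inr := isIsoBetween_mulMap_inr hP M₂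
    exact ⟨h_inl.1.1, h_inl, h_inr.1.1, h_inr⟩

end PartialGroups
end
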